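/- arXiv:1811.05793 — 2 statements merged into one kernel-verified Lean document; each statement's English description precedes it below -/
import Mathlib

section
/- Let s ≥ 2 and n ≥ 2 be integers, let K be a real number with 2 ≤ K < 2^{−36}·s/(log n)^3, and let Y ⊆ G with |Y| = n. Then the number of sets J ⊆ Y with |J| = s such that |J+J| ≤ K|J| is at most exp(2^9·λ·K^{1/6}·s^{5/6}·√(log n)) · binom(⌈(Ks+β)/2⌉, s), where β := β(Ks + 2^6·K^{7/6}·s^{5/6}·√(log n)), and where λ := log s if K = 2 and λ := min{K/(K−2), log s} if K > 2. -/
open Pointwise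

/-- `betaSubgroup G t` is the maximum of `|H|` over all finite subgroups `H ≤ G` with
`|H| ≤ t` (the trivial subgroup guarantees this is at least `1` whenever `t ≥ 1`). -/
noncomputable def betaSubgroup (G : Type*) [AddCommGroup G] (t : ℝ) : ℕ :=
  sSup {k : ℕ | ∃ H : AddSubgroup G, Nat.card H = k ∧ 0 < k ∧ (k : ℝ) ≤ t}

section Beta

variable {G : Type*} [AddCommGroup G]

theorem card_le_betaSubgroup (H : AddSubgroup G) [Finite H] {M : ℝ}
    (h : (Nat.card H : ℝ) ≤ M) : Nat.card H ≤ betaSubgroup G M := by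
  refine le_csSup ⟨⌊M⌋₊, ?_⟩ ⟨H, rfl, Nat.card_pos, h⟩
  rintro k ⟨_, _, _, hk⟩
  exact Nat.le_floor hk

theorem betaSubgroup_le {M : ℝ} (hM : 0 ≤ M) : (betaSubgroup G M : ℝ) ≤ M := by
  have : betaSubgroup G M ≤ ⌊M⌋₊ := by
    refine csSup_le' ?_
    rintro k ⟨_, _, _, hk⟩
    exact Nat.le_floor hk
  exact (Nat.cast_le.2 this).trans (Nat.floor_le hM)

end Beta

section Pollard

variable {G : Type*} [AddCommGroup G] [DecidableEq G]

/-- The number of representations of `x` as a sum of an element of `A` and an element of `B`. -/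
def sumRep (A B : Finset G) (x : G) : ℕ := (B.filter fun b => x - b ∈ A).card

/-- The representation counts of `A + B`, truncated at `t` and summed over `Z`. -/
def truncSum (Z A B : Finset G) (t : ℕ) : ℕ := ∑ x ∈ Z, min t (sumRep A B x)

theorem sumRep_le_card (A B : Finset G) (x : G) : sumRep A B x ≤ B.card :=
  Finset.card_filter_le _ _

theorem sum_sumRep (Z A B : Finset G) (h : A + B ⊆ Z) :
    ∑ x ∈ Z, sumRep A B x = A.card * B.card := by
  unfold sumRep
  simp_rw [Finset.card_filter]
  rw [Finset.sum_comm, mul_comm, ← smul_eq_mul, ← Finset.sum_const]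
  refine Finset.sum_congr rfl fun b hb => ?_
  rw [← Finset.card_filter]
  refine Finset.card_bij' (fun x _ => x - b) (fun a _ => a + b) ?_ ?_ ?_ ?_
  · simp
  · intro a ha
    simpa using ⟨h (Finset.add_mem_add ha hb), ha⟩
  · simp
  · simp

theorem sumRep_dyson (A B : Finset G) (e x : G) :
    sumRep (A ∪ (B.filter fun b => b + e ∉ A).image (· + e)) (B.filter fun b => b + e ∈ A) x +
      sumRep (A.filter fun a => a - e ∉ B) (B.filter fun b => b + e ∉ A) x ≤ sumRep A B x := by
  unfold sumRep
  have hmem : ∀ y, y ∈ (A ∪ (B.filter fun b => b + e ∉ A).image (· + e)) ↔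
      y ∈ A ∨ (y - e ∈ B ∧ y ∉ A) := by
    intro y
    simp only [Finset.mem_union, Finset.mem_image, Finset.mem_filter]
    refine or_congr_right ⟨?_, ?_⟩
    · rintro ⟨b, ⟨hb, hb'⟩, rfl⟩
      simpa using ⟨hb, hb'⟩
    · rintro ⟨h1, h2⟩
      exact ⟨y - e, ⟨h1, by simpa using h2⟩, by simp⟩
  have h1 : ((B.filter fun b => b + e ∈ A).filter fun b =>
      x - b ∈ (A ∪ (B.filter fun b => b + e ∉ A).image (· + e))).card ≤
      (B.filter fun b => b + e ∈ A ∧ x - b ∈ A).card +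
      (B.filter fun b => b + e ∉ A ∧ x - b ∈ A ∧ x - b - e ∈ B).card := by
    have h2 : (B.filter fun b => b + e ∈ A ∧ x - b ∉ A ∧ x - b - e ∈ B).card ≤
        (B.filter fun b => b + e ∉ A ∧ x - b ∈ A ∧ x - b - e ∈ B).card := by
      refine Finset.card_le_card_of_injOn (fun b => x - b - e) ?_ ?_
      · intro b hb
        simp only [Finset.coe_filter, Set.mem_ofPred_eq] at hb ⊢
        obtain ⟨hb0, hb1, hb2, hb3⟩ := hb
        refine ⟨hb3, ?_, ?_, ?_⟩
        · simpa using hb2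
        · rwa [show x - (x - b - e) = b + e by abel]
        · rwa [show x - (x - b - e) - e = b by abel]
      · intro b _ b' _ hbb
        simpa using hbb
    refine le_trans ?_ (Nat.add_le_add_left h2 _)
    refine le_trans (Finset.card_le_card ?_) (Finset.card_union_le _ _)
    intro b
    simp only [Finset.mem_filter, hmem, Finset.mem_union]
    tauto
  refine le_trans (Nat.add_le_add_right h1 _) ?_
  rw [← Finset.card_union_of_disjoint, ← Finset.card_union_of_disjoint]
  · refine Finset.card_le_card ?_
    intro b
    simp only [Finset.mem_filter, Finset.mem_union]
    tauto
  · rw [Finset.disjoint_left]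
    intro b
    simp only [Finset.mem_filter, Finset.mem_union]
    tauto
  · rw [Finset.disjoint_left]
    intro b
    simp only [Finset.mem_filter]
    tauto

/-- If `A` is stable under translation by all differences of elements of `B`, the
Pollard-type bound holds. -/
theorem truncSum_of_stable (M : ℝ) (Z A B : Finset G) (t : ℕ) (ht : 0 < t) (hA : t ≤ A.card)
    (hB : t ≤ B.card) (hZ : A + B ⊆ Z)
    (hstab : ∀ a ∈ A, ∀ b ∈ B, ∀ b' ∈ B, b' + (a - b) ∈ A) :
    (t : ℝ) * (A.card + B.card - t - betaSubgroup G M) ≤ truncSum Z A B t ∨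
      (t : ℝ) * M ≤ truncSum Z A B t := by
  obtain ⟨a₀, ha₀⟩ : A.Nonempty := Finset.card_pos.1 (by omega)
  obtain ⟨b₀, hb₀⟩ : B.Nonempty := Finset.card_pos.1 (by omega)
  have hf : (t : ℝ) * A.card ≤ truncSum Z A B t := by
    have : A.card * t ≤ truncSum Z A B t := by
      unfold truncSum
      have hsub : A.image (· + b₀) ⊆ Z := by
        intro y hy
        obtain ⟨a, ha, rfl⟩ := Finset.mem_image.1 hy
        exact hZ (Finset.add_mem_add ha hb₀)
      refine le_trans ?_ (Finset.sum_le_sum_of_subset hsub)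
      rw [← Finset.card_image_of_injective A (add_left_injective b₀)]
      refine Finset.card_nsmul_le_sum _ _ _ ?_
      intro y hy
      obtain ⟨a, ha, rfl⟩ := Finset.mem_image.1 hy
      refine le_min le_rfl (hB.trans ?_)
      unfold sumRep
      rw [Finset.filter_true_of_mem]
      intro b hb
      have := hstab a ha b hb b₀ hb₀
      rwa [show a + b₀ - b = b₀ + (a - b) by abel]
    calc (t : ℝ) * A.card = ((A.card * t : ℕ) : ℝ) := by push_cast; ring
      _ ≤ _ := by exact_mod_cast this
  let H : AddSubgroup G := AddAction.stabilizer G A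
  have hHmem : ∀ g, g ∈ H ↔ g +ᵥ A = A := fun g => AddAction.mem_stabilizer_iff
  have hmap : ∀ h : H, (h : G) + a₀ ∈ A := by
    intro h
    have h1 := (hHmem h).1 h.2
    have h2 : (h : G) +ᵥ a₀ ∈ (h : G) +ᵥ A := Finset.vadd_mem_vadd_finset ha₀
    rwa [h1] at h2
  let φ : H → A := fun h => ⟨(h : G) + a₀, hmap h⟩
  have hφ : Function.Injective φ := by
    intro h h' hh
    have := congrArg Subtype.val hh
    exact Subtype.ext (by simpa [φ] using this)
  have : Finite H := Finite.of_injective φ hφ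
  have hHA : Nat.card H ≤ A.card := by
    have := Nat.card_le_card_of_injective φ hφ
    simpa using this
  have hBH : B.card ≤ Nat.card H := by
    have hψ : ∀ b : B, (b : G) - b₀ ∈ H := by
      intro b
      rw [hHmem]
      refine Finset.eq_of_subset_of_card_le ?_ (by simp)
      intro y hy
      obtain ⟨a, ha, rfl⟩ := Finset.mem_vadd_finset.1 hy
      have := hstab a ha b₀ hb₀ b b.2
      rwa [vadd_eq_add, show (b : G) - b₀ + a = b + (a - b₀) by abel]
    have := Nat.card_le_card_of_injective (fun b : B => (⟨b - b₀, hψ b⟩ : H)) (by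
      intro b b' hb
      have := congrArg Subtype.val hb
      exact Subtype.ext (by simpa using this))
    simpa using this
  by_cases hM : (Nat.card H : ℝ) ≤ M
  · left
    have h1 : B.card ≤ betaSubgroup G M := hBH.trans (card_le_betaSubgroup H hM)
    have h2 : (B.card : ℝ) ≤ betaSubgroup G M := by exact_mod_cast h1
    refine le_trans ?_ hf
    gcongr
    have : (0 : ℝ) ≤ t := by positivity
    linarith
  · right
    refine le_trans ?_ hf
    gcongr
    have : (Nat.card H : ℝ) ≤ A.card := by exact_mod_cast hHA
    linarith

/-- A Pollard-type theorem for arbitrary abelian groups. -/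
theorem truncSum_lower_bound (M : ℝ) (Z : Finset G) (A B : Finset G) (t : ℕ) (ht : 0 < t)
    (hA : t ≤ A.card) (hB : t ≤ B.card) (hZ : A + B ⊆ Z) :
    (t : ℝ) * (A.card + B.card - t - betaSubgroup G M) ≤ truncSum Z A B t ∨
      (t : ℝ) * M ≤ truncSum Z A B t := by
  induction hm : B.card using Nat.strong_induction_on generalizing A B t with
  | _ m ih =>
  by_cases hstab : ∀ a ∈ A, ∀ b ∈ B, ∀ b' ∈ B, b' + (a - b) ∈ A
  · rw [← hm]
    exact truncSum_of_stable M Z A B t ht hA hB hZ hstab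
  push Not at hstab
  obtain ⟨a₀, ha₀, b₀, hb₀, b₁, hb₁, hnot⟩ := hstab
  set e := a₀ - b₀ with he
  set Bi := B.filter fun b => b + e ∈ A with hBi
  set Bo := B.filter fun b => b + e ∉ A with hBo
  set Au := A ∪ Bo.image (· + e) with hAu
  set Ao := A.filter fun a => a - e ∉ B with hAo
  have hdys : ∀ x, sumRep Au Bi x + sumRep Ao Bo x ≤ sumRep A B x := sumRep_dyson A B e
  have hcB : Bi.card + Bo.card = B.card := Finset.card_filter_add_card_filter_not _
  have hcAu : Au.card = A.card + Bo.card := by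
    rw [hAu, Finset.card_union_of_disjoint,
      Finset.card_image_of_injective _ (add_left_injective e)]
    rw [Finset.disjoint_right]
    intro y hy
    obtain ⟨b, hb, rfl⟩ := Finset.mem_image.1 hy
    exact (Finset.mem_filter.1 hb).2
  have hcAo : Ao.card + Bi.card = A.card := by
    rw [← Finset.card_filter_add_card_filter_not (s := A) (fun a => a - e ∉ B)]
    congr 1
    refine Finset.card_bij' (fun b _ => b + e) (fun a _ => a - e) ?_ ?_ ?_ ?_ <;>
      simp +contextual [hBi]
  have hBi_pos : 0 < Bi.card := Finset.card_pos.2 ⟨b₀, by simp [hBi, hb₀, he, ha₀]⟩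
  have hBo_pos : 0 < Bo.card := Finset.card_pos.2 ⟨b₁, by simp [hBo, hb₁, hnot]⟩
  have hZu : Au + Bi ⊆ Z := by
    intro y hy
    obtain ⟨a, ha, b, hb, rfl⟩ := Finset.mem_add.1 hy
    obtain ⟨hb1, hb2⟩ := Finset.mem_filter.1 hb
    rcases Finset.mem_union.1 ha with ha | ha
    · exact hZ (Finset.add_mem_add ha hb1)
    · obtain ⟨c, hc, rfl⟩ := Finset.mem_image.1 ha
      have hc1 := (Finset.mem_filter.1 hc).1
      rw [show c + e + b = (b + e) + c by abel]
      exact hZ (Finset.add_mem_add hb2 hc1)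
  have hZo : Ao + Bo ⊆ Z :=
    (Finset.add_subset_add (Finset.filter_subset _ _) (Finset.filter_subset _ _)).trans hZ
  by_cases htb : t ≤ Bi.card
  · have h1 : truncSum Z Au Bi t ≤ truncSum Z A B t := by
      refine Finset.sum_le_sum fun x _ => min_le_min le_rfl ?_
      have := hdys x
      omega
    have h1' : (truncSum Z Au Bi t : ℝ) ≤ truncSum Z A B t := by exact_mod_cast h1
    have h2 := ih Bi.card (by omega) Au Bi t ht (by omega) htb hZu rfl
    have h3 : (Au.card : ℝ) + Bi.card = A.card + B.card := by
      rw [hcAu, ← hcB]; push_cast; ring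
    rw [h3] at h2
    rw [← hm]
    exact h2.imp (fun h => h.trans h1') (fun h => h.trans h1')
  · push Not at htb
    have h1 : Au.card * Bi.card + truncSum Z Ao Bo (t - Bi.card) ≤ truncSum Z A B t := by
      rw [← sum_sumRep Z Au Bi hZu]
      unfold truncSum
      rw [← Finset.sum_add_distrib]
      refine Finset.sum_le_sum fun x _ => ?_
      have h2 := hdys x
      have h3 := sumRep_le_card Au Bi x
      omega
    have h1' : (Au.card : ℝ) * Bi.card + truncSum Z Ao Bo (t - Bi.card) ≤ truncSum Z A B t := by
      exact_mod_cast h1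
    have h2 := ih Bo.card (by omega) Ao Bo (t - Bi.card) (by omega) (by omega) (by omega) hZo rfl
    have e1 : (Au.card : ℝ) = A.card + Bo.card := by exact_mod_cast hcAu
    have e2 : (Ao.card : ℝ) = A.card - Bi.card := by
      rw [← hcAo]; push_cast; ring
    have e3 : (B.card : ℝ) = Bi.card + Bo.card := by exact_mod_cast hcB.symm
    have e4 : ((t - Bi.card : ℕ) : ℝ) = t - Bi.card := by
      rw [Nat.cast_sub htb.le]
    have e5 : (Bi.card : ℝ) ≤ t := by exact_mod_cast htb.le
    have e6 : (0 : ℝ) ≤ Bi.card := by positivity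
    have e7 : (0 : ℝ) ≤ betaSubgroup G M := by positivity
    have e8 : (0 : ℝ) ≤ Bo.card := by positivity
    rw [← hm, e3]
    rw [e1] at h1'
    rw [e2, e4] at h2
    rcases h2 with h2 | h2
    · left
      nlinarith
    · by_cases hM : M ≤ (A.card : ℝ) + Bo.card
      · right
        nlinarith
      · left
        push Not at hM
        have h4 : ((t : ℝ) - Bi.card) * (A.card + Bo.card) ≤ ((t : ℝ) - Bi.card) * M :=
          mul_le_mul_of_nonneg_left hM.le (by linarith)
        nlinarith

end Pollard

section Containers

variable {G : Type*} [AddCommGroup G] [DecidableEq G]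

/-- The number of `t ∈ T` for which `a + t` lies outside `C`. -/
def missing (C T : Finset G) (a : G) : ℕ := (T.filter fun t => a + t ∉ C).card

theorem missing_le_card (C T : Finset G) (a : G) : missing C T a ≤ T.card :=
  Finset.card_filter_le _ _

theorem sum_missing_comm (C S T : Finset G) :
    ∑ a ∈ S, missing C T a = ∑ b ∈ T, missing C S b := by
  unfold missing
  simp_rw [Finset.card_filter]
  rw [Finset.sum_comm]
  simp_rw [add_comm]

theorem truncSum_le (A C : Finset G) (t : ℕ) :
    truncSum (A + A) A A t ≤ t * C.card + ∑ a ∈ A, missing C A a := by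
  unfold truncSum
  rw [← Finset.sum_filter_add_sum_filter_not (A + A) (· ∈ C)]
  refine Nat.add_le_add ?_ ?_
  · calc ∑ x ∈ (A + A).filter (· ∈ C), min t (sumRep A A x)
        ≤ ((A + A).filter (· ∈ C)).card • t :=
          Finset.sum_le_card_nsmul _ _ _ fun x _ => min_le_left _ _
      _ ≤ t * C.card := by
          rw [smul_eq_mul, mul_comm]
          refine Nat.mul_le_mul_left _ (Finset.card_le_card ?_)
          intro x hx
          exact (Finset.mem_filter.1 hx).2
  · calc ∑ x ∈ (A + A).filter (· ∉ C), min t (sumRep A A x)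
        ≤ ∑ x ∈ (A + A).filter (· ∉ C), sumRep A A x :=
          Finset.sum_le_sum fun x _ => min_le_right _ _
      _ ≤ ∑ a ∈ A, missing C A a := by
          unfold sumRep missing
          rw [Finset.sum_congr rfl fun x _ => Finset.card_filter _ _, Finset.sum_comm]
          refine Finset.sum_le_sum fun b hb => ?_
          rw [← Finset.card_filter]
          refine Finset.card_le_card_of_injOn (fun x => x - b) ?_ ?_
          · intro x hx
            simp only [Finset.coe_filter, Set.mem_ofPred_eq, Finset.mem_filter] at hx ⊢
            exact ⟨hx.2, by simpa using hx.1.2⟩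
          · intro x _ y _ hxy
            simpa using hxy

/-- If almost all sums of pairs from `A` lie in `C`, then `A` has size at most about
`(|C| + β) / 2`. -/
theorem card_le_of_sum_missing_lt {X M η : ℝ} {A C : Finset G} (hA : A.Nonempty) (hη : 0 < η)
    (hη1 : η ≤ 1) (hC : (C.card : ℝ) ≤ X) (hM : X + η * A.card < M)
    (hP : ((∑ a ∈ A, missing C A a : ℕ) : ℝ) < η ^ 2 * A.card ^ 2) :
    2 * (A.card : ℝ) ≤ X + betaSubgroup G M + 2 * η * A.card + 1 := by
  have ha : (0 : ℝ) < A.card := by exact_mod_cast hA.card_pos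
  set a : ℝ := (A.card : ℝ) with ha_def
  set t := ⌈η * a⌉₊ with ht
  have hηa : 0 < η * a := by positivity
  have ht0 : 0 < t := Nat.ceil_pos.2 hηa
  have htA : t ≤ A.card := Nat.ceil_le.2 (by nlinarith)
  have h1 : η * a ≤ t := Nat.le_ceil _
  have h2 : (t : ℝ) < η * a + 1 := Nat.ceil_lt_add_one hηa.le
  have htp : (0 : ℝ) < t := by exact_mod_cast ht0
  have hup : (truncSum (A + A) A A t : ℝ) ≤ t * C.card + (∑ a ∈ A, missing C A a : ℕ) := by
    exact_mod_cast truncSum_le A C t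
  have hP' : ((∑ a ∈ A, missing C A a : ℕ) : ℝ) ≤ t * (η * a) := by
    refine hP.le.trans ?_
    calc η ^ 2 * a ^ 2 = (η * a) * (η * a) := by ring
      _ ≤ t * (η * a) := by gcongr
  have hup' : (truncSum (A + A) A A t : ℝ) ≤ t * (X + η * a) := by
    have : (t : ℝ) * C.card ≤ t * X := by gcongr
    rw [mul_add]
    linarith
  rcases truncSum_lower_bound M (A + A) A A t ht0 htA htA le_rfl with h | h
  · have := le_of_mul_le_mul_left (h.trans hup') htp
    linarith
  · have := le_of_mul_le_mul_left (h.trans hup') htp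
    linarith

/-- A greedily chosen `U ⊆ J` such that no element of `J` can enlarge `C ∪ (U + T)` much. -/
theorem exists_saturated (J T C : Finset G) {r : ℝ} (hr : 0 < r) :
    ∃ U ⊆ J, (C.card : ℝ) + r * U.card ≤ (C ∪ (U + T)).card ∧
      ∀ a ∈ J, (missing (C ∪ (U + T)) T a : ℝ) < r := by
  let S := J.powerset.filter fun U => (C.card : ℝ) + r * U.card ≤ (C ∪ (U + T)).card
  have hS : S.Nonempty := ⟨∅, by simp [S]⟩
  obtain ⟨U, hU, hmax⟩ := Finset.exists_max_image S Finset.card hS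
  simp only [S, Finset.mem_filter, Finset.mem_powerset] at hU hmax
  refine ⟨U, hU.1, hU.2, fun a ha => ?_⟩
  by_contra! hlt
  have haU : a ∉ U := by
    intro haU
    have : missing (C ∪ (U + T)) T a = 0 := by
      unfold missing
      rw [Finset.card_eq_zero, Finset.filter_eq_empty_iff]
      intro t ht
      simp [Finset.add_mem_add haU ht]
    rw [this] at hlt
    simp at hlt
    linarith
  have hcard : (insert a U).card = U.card + 1 := Finset.card_insert_of_notMem haU
  have hgrow : (C ∪ (U + T)).card + missing (C ∪ (U + T)) T a ≤
      (C ∪ (insert a U + T)).card := by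
    unfold missing
    rw [← Finset.card_image_of_injective (T.filter fun t => a + t ∉ C ∪ (U + T))
      (add_right_injective a), ← Finset.card_union_of_disjoint]
    · refine Finset.card_le_card ?_
      intro x hx
      simp only [Finset.mem_union, Finset.mem_image, Finset.mem_filter] at hx ⊢
      rcases hx with (hx | hx) | ⟨t, ⟨ht, _⟩, rfl⟩
      · exact Or.inl hx
      · exact Or.inr (Finset.add_subset_add_right (Finset.subset_insert _ _) hx)
      · exact Or.inr (Finset.add_mem_add (Finset.mem_insert_self _ _) ht)
    · rw [Finset.disjoint_right]
      intro x hx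
      obtain ⟨t, ht, rfl⟩ := Finset.mem_image.1 hx
      exact (Finset.mem_filter.1 ht).2
  have hgrow' : ((C ∪ (U + T)).card : ℝ) + missing (C ∪ (U + T)) T a ≤
      (C ∪ (insert a U + T)).card := by exact_mod_cast hgrow
  have := hmax (insert a U) ⟨Finset.insert_subset ha hU.1, by
    rw [hcard]; push_cast; linarith [hU.2]⟩
  omega

/-- The container for sets `J ⊆ A` with fingerprint `(T, U)`. -/
noncomputable def container (ε : ℝ) (q : ℕ) (A C T U : Finset G) : Finset G :=
  open Classical in
  if T.card < q then (A.filter fun a => (missing C A a : ℝ) < ε / 2 * A.card) ∪ T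
  else A.filter fun a => (missing (C ∪ (U + T)) T a : ℝ) < ε / 4 * q

/-- The progress made when passing from `(A, C)` to the container with fingerprint `(T, U)`. -/
def Progress (ε : ℝ) (q : ℕ) (A C T U : Finset G) : Prop :=
  T.card ≤ q ∧ (C.card : ℝ) + ε / 4 * q * U.card ≤ (C ∪ (U + T)).card ∧
    ((container ε q A C T U).card ≤ (1 - ε / 8) * A.card ∨
      (C.card : ℝ) + ε / 8 * A.card ≤ (C ∪ (U + T)).card)

theorem sum_missing_le (C C' S T : Finset G) :
    ∑ a ∈ S, missing C T a ≤ ∑ a ∈ S, missing C' T a + T.card * (C' \ C).card := by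
  rw [sum_missing_comm, sum_missing_comm C', ← smul_eq_mul, ← Finset.sum_const,
    ← Finset.sum_add_distrib]
  refine Finset.sum_le_sum fun t _ => ?_
  unfold missing
  have h1 : (S.filter fun a => t + a ∈ C' \ C).card ≤ (C' \ C).card :=
    Finset.card_le_card_of_injOn (t + ·) (by intro a; simp) fun a _ b _ hab => by simpa using hab
  refine le_trans ?_ (Nat.add_le_add_left h1 _)
  refine le_trans (Finset.card_le_card ?_) (Finset.card_union_le _ _)
  intro a
  simp only [Finset.mem_filter, Finset.mem_union, Finset.mem_sdiff]
  tauto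

/-- If many pairs from `A` have their sum outside `C`, then every `J ⊆ A` with `C ⊆ J + J` has
a fingerprint making progress. -/
theorem exists_fingerprint {ε : ℝ} {q : ℕ} {A C J : Finset G} (hε : 0 < ε)
    (hq : 0 < q) (hqA : (q : ℝ) ≤ 3 * ε / 8 * A.card) (hJA : J ⊆ A) (hCJ : C ⊆ J + J)
    (hP : ε * A.card ^ 2 ≤ ((∑ a ∈ A, missing C A a : ℕ) : ℝ)) :
    ∃ T ⊆ J, ∃ U ⊆ J, Progress ε q A C T U ∧ J ⊆ container ε q A C T U ∧
      C ∪ (U + T) ⊆ J + J := by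
  classical
  have hqr : (0 : ℝ) < q := by exact_mod_cast hq
  have hA0 : (0 : ℝ) < A.card := by
    by_contra! h
    have : 3 * ε / 8 * (A.card : ℝ) ≤ 0 := mul_nonpos_of_nonneg_of_nonpos (by positivity) h
    linarith
  set L := A.filter fun a => (missing C A a : ℝ) < ε / 2 * A.card with hL
  set H := A.filter fun a => ¬ (missing C A a : ℝ) < ε / 2 * A.card with hH
  have hLH : (L.card : ℝ) + H.card = A.card := by
    exact_mod_cast Finset.card_filter_add_card_filter_not _
  have hHcard : ε / 2 * A.card ≤ H.card := by
    have h1 : ((∑ a ∈ A, missing C A a : ℕ) : ℝ) ≤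
        H.card * A.card + A.card * (ε / 2 * A.card) := by
      push_cast
      rw [← Finset.sum_filter_add_sum_filter_not A
        (fun a => (missing C A a : ℝ) < ε / 2 * A.card), add_comm]
      refine add_le_add ?_ ?_
      · rw [← nsmul_eq_mul]
        refine Finset.sum_le_card_nsmul _ _ _ fun a _ => ?_
        exact_mod_cast missing_le_card C A a
      · have : ((L.card : ℝ)) * (ε / 2 * A.card) ≤ A.card * (ε / 2 * A.card) := by
          gcongr
          exact Finset.filter_subset _ _
        refine le_trans ?_ this
        rw [← nsmul_eq_mul]
        exact Finset.sum_le_card_nsmul _ _ _ fun a ha => (Finset.mem_filter.1 ha).2.le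
    have h2 : A.card * (ε / 2 * A.card) ≤ A.card * (H.card : ℝ) := by nlinarith
    exact le_of_mul_le_mul_left h2 hA0
  by_cases hcase : (J ∩ H).card < q
  · refine ⟨J ∩ H, Finset.inter_subset_left, ∅, Finset.empty_subset _, ?_, ?_, by simpa using hCJ⟩
    · refine ⟨hcase.le, by simp, Or.inl ?_⟩
      unfold container
      rw [if_pos hcase]
      have h1 : ((L ∪ (J ∩ H)).card : ℝ) ≤ L.card + (J ∩ H).card := by
        exact_mod_cast Finset.card_union_le _ _
      have h2 : ((J ∩ H).card : ℝ) ≤ q := by exact_mod_cast hcase.le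
      refine h1.trans ?_
      linarith
    · unfold container
      rw [if_pos hcase]
      intro a ha
      have := hJA ha
      simp only [Finset.mem_union, Finset.mem_filter, Finset.mem_inter, hH]
      tauto
  · push Not at hcase
    obtain ⟨T, hT, hTq⟩ := Finset.exists_subset_card_eq hcase
    have hTJ : T ⊆ J := hT.trans Finset.inter_subset_left
    obtain ⟨U, hU, hU1, hU2⟩ := exists_saturated J T C (r := ε / 4 * q) (by positivity)
    refine ⟨T, hTJ, U, hU, ?_, ?_, Finset.union_subset hCJ (Finset.add_subset_add hU hTJ)⟩
    · refine ⟨hTq.le, hU1, ?_⟩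
      unfold container
      rw [if_neg (by omega)]
      set C' := C ∪ (U + T) with hC'
      set A' := A.filter fun a => (missing C' T a : ℝ) < ε / 4 * q with hA'
      set R := A.filter fun a => ¬ (missing C' T a : ℝ) < ε / 4 * q with hR
      have hAR : (A'.card : ℝ) + R.card = A.card := by
        exact_mod_cast Finset.card_filter_add_card_filter_not _
      have hCC : C ⊆ C' := Finset.subset_union_left
      have hCd : ((C' \ C).card : ℝ) = C'.card - C.card := by
        rw [Finset.card_sdiff_of_subset hCC, Nat.cast_sub (Finset.card_le_card hCC)]
      have h1 : (q : ℝ) * (ε / 2 * A.card) ≤ ((∑ a ∈ A, missing C T a : ℕ) : ℝ) := by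
        rw [sum_missing_comm, ← hTq, ← nsmul_eq_mul]
        push_cast
        refine Finset.card_nsmul_le_sum _ _ _ fun t ht => ?_
        have := (Finset.mem_inter.1 (hT ht)).2
        exact not_lt.1 (Finset.mem_filter.1 this).2
      have h2 : ((∑ a ∈ A, missing C T a : ℕ) : ℝ) ≤
          ((∑ a ∈ A, missing C' T a : ℕ) : ℝ) + q * (C' \ C).card := by
        have := sum_missing_le C C' A T
        rw [hTq] at this
        exact_mod_cast this
      have h3 : ((∑ a ∈ A, missing C' T a : ℕ) : ℝ) ≤ A.card * (ε / 4 * q) + R.card * q := by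
        push_cast
        rw [← Finset.sum_filter_add_sum_filter_not A
          (fun a => (missing C' T a : ℝ) < ε / 4 * q)]
        refine add_le_add ?_ ?_
        · have : ((A'.card : ℝ)) * (ε / 4 * q) ≤ A.card * (ε / 4 * q) := by
            gcongr
            exact Finset.filter_subset _ _
          refine le_trans ?_ this
          rw [← nsmul_eq_mul]
          exact Finset.sum_le_card_nsmul _ _ _ fun a ha => (Finset.mem_filter.1 ha).2.le
        · rw [← nsmul_eq_mul]
          refine Finset.sum_le_card_nsmul _ _ _ fun a _ => ?_
          rw [← hTq]
          exact_mod_cast missing_le_card C' T a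
      have h4 : (q : ℝ) * (ε / 4 * A.card) ≤ q * (R.card + (C'.card - C.card)) := by
        rw [hCd] at h2
        nlinarith
      have h5 := le_of_mul_le_mul_left h4 hqr
      by_contra! hcon
      linarith [hcon.1, hcon.2]
    · unfold container
      rw [if_neg (by omega)]
      intro a ha
      exact Finset.mem_filter.2 ⟨hJA ha, hU2 a ha⟩

theorem container_card_le_of_subset {ε : ℝ} {q : ℕ} {A C T U : Finset G} (hT : T ⊆ A) :
    container ε q A C T U ⊆ A := by
  unfold container
  split_ifs
  · exact Finset.union_subset (Finset.filter_subset _ _) hT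
  · exact Finset.filter_subset _ _

end Containers

section Counting

variable {G : Type*} [AddCommGroup G] [DecidableEq G]

theorem sum_powerset_exp_le {α : Type*} (Y : Finset α) (hY : 0 < Y.card) :
    ∑ U ∈ Y.powerset, Real.exp (-(Real.log Y.card * U.card)) ≤ Real.exp 1 := by
  have hn : (0 : ℝ) < Y.card := by exact_mod_cast hY
  have h1 : ∀ U ∈ Y.powerset, Real.exp (-(Real.log Y.card * U.card)) =
      (1 / (Y.card : ℝ)) ^ U.card * 1 ^ (Y.card - U.card) := by
    intro U _
    rw [one_pow, mul_one, one_div, ← Real.exp_log hn, ← Real.exp_neg, ← Real.exp_nat_mul,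
      Real.exp_log hn]
    congr 1
    ring
  rw [Finset.sum_congr rfl h1, Finset.sum_pow_mul_eq_add_pow]
  calc (1 / (Y.card : ℝ) + 1) ^ Y.card ≤ Real.exp (1 / Y.card) ^ Y.card := by
        gcongr
        exact Real.add_one_le_exp _
    _ = Real.exp 1 := by
        rw [← Real.exp_nat_mul]
        congr 1
        field_simp

theorem card_powerset_filter_le {α : Type*} (Y : Finset α) (hY : 0 < Y.card) (q : ℕ) :
    ((Y.powerset.filter fun T => T.card ≤ q).card : ℝ) ≤
      Real.exp (q * Real.log Y.card + 1) := by
  have hL : 0 ≤ Real.log Y.card := Real.log_natCast_nonneg _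
  calc ((Y.powerset.filter fun T => T.card ≤ q).card : ℝ)
      = ∑ T ∈ Y.powerset.filter fun T => T.card ≤ q, (1 : ℝ) := by simp
    _ ≤ ∑ T ∈ Y.powerset.filter fun T => T.card ≤ q,
          Real.exp (q * Real.log Y.card) * Real.exp (-(Real.log Y.card * T.card)) := by
        refine Finset.sum_le_sum fun T hT => ?_
        have : (T.card : ℝ) ≤ q := by exact_mod_cast (Finset.mem_filter.1 hT).2
        rw [← Real.exp_add]
        refine Real.one_le_exp ?_
        nlinarith
    _ ≤ ∑ T ∈ Y.powerset,
          Real.exp (q * Real.log Y.card) * Real.exp (-(Real.log Y.card * T.card)) :=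
        Finset.sum_le_sum_of_subset_of_nonneg (Finset.filter_subset _ _)
          fun _ _ _ => by positivity
    _ ≤ _ := by
        rw [← Finset.mul_sum, Real.exp_add]
        gcongr
        exact sum_powerset_exp_le Y hY

/-- The `s`-subsets `J` of `A` with `|J + J| ≤ X` and `C ⊆ J + J`. -/
noncomputable def smallSumsetFamily (s : ℕ) (X : ℝ) (A C : Finset G) : Finset (Finset G) :=
  (A.powersetCard s).filter fun J => ((J + J).card : ℝ) ≤ X ∧ C ⊆ J + J

theorem mem_smallSumsetFamily {s : ℕ} {X : ℝ} {A C J : Finset G} :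
    J ∈ smallSumsetFamily s X A C ↔
      (J ⊆ A ∧ J.card = s) ∧ ((J + J).card : ℝ) ≤ X ∧ C ⊆ J + J := by
  simp [smallSumsetFamily, Finset.mem_powersetCard]

theorem card_smallSumsetFamily_le_choose (s : ℕ) (X : ℝ) (A C : Finset G) :
    (smallSumsetFamily s X A C).card ≤ A.card.choose s :=
  (Finset.card_filter_le _ _).trans (Finset.card_powersetCard _ _).le

/-- The logarithm of the number of containers needed from the state `(A, C)` on. -/
noncomputable def containerCost {α : Type*} (L X ε : ℝ) (q : ℕ) (A C : Finset α) : ℝ :=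
  8 * (q * L + 2) / ε * Real.log A.card +
    (16 * (q * L + 2) / (ε * X) + 4 * L / (ε * q)) * (X - C.card)

theorem containerCost_progress {L X ε : ℝ} {q : ℕ} {A C T U : Finset G} (hL : 0 ≤ L)
    (hX : 0 < X) (hε : 0 < ε) (hq : 0 < q) (hA : X / 2 ≤ A.card) (hT : T ⊆ A)
    (hne : (container ε q A C T U).Nonempty) (hp : Progress ε q A C T U) :
    containerCost L X ε q (container ε q A C T U) (C ∪ (U + T)) ≤
      containerCost L X ε q A C - (q * L + 2) - L * U.card := by
  obtain ⟨-, hU, hp⟩ := hp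
  set A' := container ε q A C T U
  set C' := C ∪ (U + T)
  have hqr : (0 : ℝ) < q := by exact_mod_cast hq
  have hA' : (0 : ℝ) < A'.card := by exact_mod_cast hne.card_pos
  have hA'A : (A'.card : ℝ) ≤ A.card := by
    exact_mod_cast Finset.card_le_card (container_card_le_of_subset hT)
  have hA0 : (0 : ℝ) < A.card := hA'.trans_le hA'A
  have hCC : (C.card : ℝ) ≤ C'.card := by
    exact_mod_cast Finset.card_le_card Finset.subset_union_left
  set g := q * L + 2 with hg
  have hg0 : 0 < g := by positivity
  have hlog : Real.log A'.card ≤ Real.log A.card := Real.log_le_log hA' hA'A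
  have h1 : L * U.card ≤ 4 * L / (ε * q) * (C'.card - C.card) := by
    calc L * U.card = 4 * L / (ε * q) * (ε / 4 * q * U.card) := by field_simp
      _ ≤ _ := by
        gcongr
        linarith
  have h2 : 0 ≤ 16 * g / (ε * X) * (C'.card - C.card) :=
    mul_nonneg (by positivity) (by linarith)
  have h3 : 8 * g / ε * Real.log A'.card ≤ 8 * g / ε * Real.log A.card := by gcongr
  have key : g ≤ 8 * g / ε * (Real.log A.card - Real.log A'.card) +
      16 * g / (ε * X) * (C'.card - C.card) := by
    rcases hp with hp | hp
    · have h4 : ε / 8 ≤ Real.log A.card - Real.log A'.card := by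
        have h5 : (A'.card : ℝ) ≤ Real.exp (-(ε / 8)) * A.card := by
          refine hp.trans ?_
          gcongr
          linarith [Real.add_one_le_exp (-(ε / 8))]
        have h6 := Real.log_le_log hA' h5
        rw [Real.log_mul (by positivity) hA0.ne', Real.log_exp] at h6
        linarith
      have : g ≤ 8 * g / ε * (Real.log A.card - Real.log A'.card) := by
        calc g = 8 * g / ε * (ε / 8) := by field_simp
          _ ≤ _ := by gcongr
      linarith
    · have : g ≤ 16 * g / (ε * X) * (C'.card - C.card) := by
        calc g = 16 * g / (ε * X) * (ε / 8 * (X / 2)) := by field_simp; norm_num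
          _ ≤ 16 * g / (ε * X) * (ε / 8 * A.card) := by gcongr
          _ ≤ _ := by
            gcongr
            linarith
      have h7 : 8 * g / ε * (Real.log A.card - Real.log A'.card) =
        8 * g / ε * Real.log A.card - 8 * g / ε * Real.log A'.card := by ring
      linarith
  unfold containerCost
  rw [← hg]
  nlinarith

/-- The container bound: the family is covered by few containers, each of which is small. -/
theorem card_smallSumsetFamily_le {Y : Finset G} {s q : ℕ} {X ε B : ℝ} (hY : 0 < Y.card)
    (hs : 0 < s) (hX : 0 < X) (hε : 0 < ε) (hq : 0 < q) (hqX : (q : ℝ) ≤ 3 * ε / 16 * X)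
    (hB : 0 ≤ B)
    (hterm : ∀ A C : Finset G, (C.card : ℝ) ≤ X →
      ((A.card : ℝ) < X / 2 ∨ ((∑ a ∈ A, missing C A a : ℕ) : ℝ) < ε * A.card ^ 2) →
      (A.card.choose s : ℝ) ≤ B) (A C : Finset G) (hA : A ⊆ Y) :
    ((smallSumsetFamily s X A C).card : ℝ) ≤
      B * Real.exp (containerCost (Real.log Y.card) X ε q A C) := by
  set L := Real.log Y.card with hLdef
  have hL : 0 ≤ L := Real.log_natCast_nonneg _
  have hqr : (0 : ℝ) < q := by exact_mod_cast hq
  obtain ⟨m, hm⟩ := exists_nat_gt (containerCost L X ε q A C)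
  induction m generalizing A C with
  | zero =>
    rcases (smallSumsetFamily s X A C).eq_empty_or_nonempty with h0 | ⟨J, hJ⟩
    · rw [h0]; simp; positivity
    exfalso
    obtain ⟨⟨hJA, hJs⟩, hJX, hCJ⟩ := mem_smallSumsetFamily.1 hJ
    have hC : (C.card : ℝ) ≤ X := le_trans (by exact_mod_cast Finset.card_le_card hCJ) hJX
    have h1 : 0 ≤ Real.log A.card := Real.log_natCast_nonneg _
    have h2 : 0 ≤ X - C.card := by linarith
    have : 0 ≤ containerCost L X ε q A C := by unfold containerCost; positivity
    simp at hm
    linarith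
  | succ m ih =>
    rcases (smallSumsetFamily s X A C).eq_empty_or_nonempty with h0 | ⟨J₀, hJ₀⟩
    · rw [h0]; simp; positivity
    have hC : (C.card : ℝ) ≤ X := by
      obtain ⟨-, hJX, hCJ⟩ := mem_smallSumsetFamily.1 hJ₀
      exact le_trans (by exact_mod_cast Finset.card_le_card hCJ) hJX
    by_cases hT : (A.card : ℝ) < X / 2 ∨ ((∑ a ∈ A, missing C A a : ℕ) : ℝ) < ε * A.card ^ 2
    · have h1 : 0 ≤ Real.log A.card := Real.log_natCast_nonneg _
      have h2 : 0 ≤ X - C.card := by linarith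
      have h3 : 0 ≤ containerCost L X ε q A C := by unfold containerCost; positivity
      calc ((smallSumsetFamily s X A C).card : ℝ) ≤ A.card.choose s := by
            exact_mod_cast card_smallSumsetFamily_le_choose s X A C
        _ ≤ B := hterm A C hC hT
        _ ≤ _ := le_mul_of_one_le_right hB (Real.one_le_exp h3)
    push Not at hT
    obtain ⟨hAX, hP⟩ := hT
    classical
    set W := (Y.powerset.filter fun T => T.card ≤ q) ×ˢ Y.powerset with hW
    set S := W.filter fun p => p.1 ⊆ A ∧ (container ε q A C p.1 p.2).Nonempty ∧
      Progress ε q A C p.1 p.2 with hS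
    have hcover : smallSumsetFamily s X A C ⊆ S.biUnion fun p =>
        smallSumsetFamily s X (container ε q A C p.1 p.2) (C ∪ (p.2 + p.1)) := by
      intro J hJ
      obtain ⟨⟨hJA, hJs⟩, hJX, hCJ⟩ := mem_smallSumsetFamily.1 hJ
      obtain ⟨T, hTJ, U, hUJ, hp, hJc, hC'⟩ :=
        exists_fingerprint hε hq (by nlinarith) hJA hCJ hP
      have hJne : J.Nonempty := Finset.card_pos.1 (by omega)
      refine Finset.mem_biUnion.2 ⟨(T, U), ?_, mem_smallSumsetFamily.2 ⟨⟨hJc, hJs⟩, hJX, hC'⟩⟩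
      simp only [hS, hW, Finset.mem_filter, Finset.mem_product, Finset.mem_powerset]
      exact ⟨⟨⟨(hTJ.trans hJA).trans hA, hp.1⟩, (hUJ.trans hJA).trans hA⟩, hTJ.trans hJA,
        hJne.mono hJc, hp⟩
    set Ψ := containerCost L X ε q A C with hΨ
    have hpt : ∀ p ∈ S,
        ((smallSumsetFamily s X (container ε q A C p.1 p.2) (C ∪ (p.2 + p.1))).card : ℝ) ≤
          B * Real.exp (Ψ - (q * L + 2)) * Real.exp (-(L * p.2.card)) := by
      intro p hp
      obtain ⟨-, hTA, hne, hpr⟩ := Finset.mem_filter.1 hp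
      have h1 := containerCost_progress hL hX hε hq hAX hTA hne hpr
      have h2 : 0 ≤ L * (p.2.card : ℝ) := by positivity
      have h3 : 0 ≤ q * L := by positivity
      refine (ih _ _ ((container_card_le_of_subset hTA).trans hA) ?_).trans ?_
      · push_cast at hm
        linarith
      · rw [mul_assoc, ← Real.exp_add]
        gcongr
        linarith
    calc ((smallSumsetFamily s X A C).card : ℝ)
        ≤ ∑ p ∈ S, ((smallSumsetFamily s X (container ε q A C p.1 p.2)
            (C ∪ (p.2 + p.1))).card : ℝ) := by
          exact_mod_cast (Finset.card_le_card hcover).trans Finset.card_biUnion_le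
      _ ≤ ∑ p ∈ S, B * Real.exp (Ψ - (q * L + 2)) * Real.exp (-(L * p.2.card)) :=
          Finset.sum_le_sum hpt
      _ ≤ ∑ p ∈ W, B * Real.exp (Ψ - (q * L + 2)) * Real.exp (-(L * p.2.card)) :=
          Finset.sum_le_sum_of_subset_of_nonneg (Finset.filter_subset _ _)
            fun _ _ _ => by positivity
      _ = B * Real.exp (Ψ - (q * L + 2)) *
            (((Y.powerset.filter fun T => T.card ≤ q).card : ℝ) *
              ∑ U ∈ Y.powerset, Real.exp (-(L * U.card))) := by
          rw [← Finset.mul_sum, hW, Finset.sum_product]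
          simp
      _ ≤ B * Real.exp (Ψ - (q * L + 2)) * (Real.exp (q * L + 1) * Real.exp 1) := by
          gcongr
          · exact card_powerset_filter_le Y hY q
          · exact sum_powerset_exp_le Y hY
      _ = B * Real.exp Ψ := by
          rw [mul_assoc, ← Real.exp_add, ← Real.exp_add]
          congr 2
          ring

end Counting

section Binomial

theorem choose_add_le {s N : ℕ} (hN : s ≤ N) {ρ : ℝ} (hρ1 : 1 ≤ ρ)
    (hρ : (N : ℝ) + 1 ≤ ρ * (N + 1 - s)) (k : ℕ) :
    ((N + k).choose s : ℝ) ≤ ρ ^ k * N.choose s := by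
  induction k with
  | zero => simp
  | succ k ih =>
    have h1 : ((N + k + 1).choose s : ℝ) * (N + k + 1 - s) = (N + k + 1) * (N + k).choose s := by
      have := Nat.choose_mul_succ_eq (N + k) s
      have h2 : ((N + k + 1 - s : ℕ) : ℝ) = N + k + 1 - s := by
        rw [Nat.cast_sub (by omega)]; push_cast; ring
      rw [← h2, mul_comm ((N : ℝ) + k + 1)]
      exact_mod_cast this.symm
    have hs : (s : ℝ) ≤ N := by exact_mod_cast hN
    have hk : (0 : ℝ) ≤ k := by positivity
    have hpos : (0 : ℝ) < N + k + 1 - s := by linarith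
    have h3 : (N : ℝ) + k + 1 ≤ ρ * (N + k + 1 - s) := by nlinarith
    have h4 : ((N + k + 1).choose s : ℝ) ≤ ρ * (N + k).choose s := by
      refine le_of_mul_le_mul_right ?_ hpos
      rw [h1]
      nlinarith [Nat.cast_nonneg (α := ℝ) ((N + k).choose s)]
    rw [← add_assoc, pow_succ']
    calc _ ≤ _ := h4
      _ ≤ ρ * (ρ ^ k * N.choose s) := by gcongr
      _ = _ := by ring

theorem choose_le_exp_mul_choose {s N a : ℕ} (hN : s ≤ N) {x d : ℝ} (hx : 0 ≤ x) (hd : 0 ≤ d)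
    (hx' : (N : ℝ) + 1 ≤ Real.exp x * (N + 1 - s)) (ha : (a : ℝ) ≤ N + d) :
    (a.choose s : ℝ) ≤ Real.exp (x * d) * N.choose s := by
  rcases le_total a N with h | h
  · calc (a.choose s : ℝ) ≤ N.choose s := by exact_mod_cast Nat.choose_le_choose s h
      _ ≤ _ := le_mul_of_one_le_left (by positivity) (Real.one_le_exp (by positivity))
  · obtain ⟨k, rfl⟩ := Nat.exists_eq_add_of_le h
    push_cast at ha
    refine (choose_add_le hN (Real.one_le_exp hx) hx' k).trans ?_
    rw [← Real.exp_nat_mul]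
    refine mul_le_mul_of_nonneg_right (Real.exp_le_exp.2 ?_) (by positivity)
    nlinarith

end Binomial

section Parameters

variable {G : Type*} [AddCommGroup G] [DecidableEq G]

theorem card_mul_sub_le_sum_missing (A C : Finset G) :
    (A.card : ℝ) * (A.card - C.card) ≤ ((∑ a ∈ A, missing C A a : ℕ) : ℝ) := by
  push_cast
  rw [← nsmul_eq_mul]
  refine Finset.card_nsmul_le_sum _ _ _ fun a _ => ?_
  have h1 : (A.filter fun b => a + b ∈ C).card ≤ C.card :=
    Finset.card_le_card_of_injOn (a + ·) (by intro b; simp) fun b _ b' _ h => by simpa using h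
  have h2 : (A.filter fun b => a + b ∈ C).card + missing C A a = A.card :=
    Finset.card_filter_add_card_filter_not _
  have h3 : A.card ≤ C.card + missing C A a := by omega
  have h4 : (A.card : ℝ) ≤ C.card + missing C A a := by exact_mod_cast h3
  linarith

/-- The size of a terminal container. -/
theorem card_le_of_terminal {s K D : ℝ} (hs : 0 < s) (hK : 2 ≤ K) (hD : 1 ≤ D) (hDs : 64 * D ≤ s)
    {A C : Finset G} (hC : (C.card : ℝ) ≤ K * s)
    (h : (A.card : ℝ) < K * s / 2 ∨
      ((∑ a ∈ A, missing C A a : ℕ) : ℝ) < 16 * D ^ 2 / s ^ 2 * A.card ^ 2) :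
    (A.card : ℝ) ≤ (K * s + betaSubgroup G (K * s + 64 * K * D)) / 2 + 9 * K * D := by
  have hβ : (0 : ℝ) ≤ betaSubgroup G (K * s + 64 * K * D) := by positivity
  have hX : 0 < K * s := by positivity
  have hKD : 2 ≤ K * D := by nlinarith
  rcases h with h | h
  · linarith
  rcases A.eq_empty_or_nonempty with rfl | hA
  · simp; positivity
  have ha : (0 : ℝ) < A.card := by exact_mod_cast hA.card_pos
  have hδ : D / s ≤ 1 / 64 := by rw [div_le_iff₀ hs]; linarith
  have hδ0 : 0 < D / s := by positivity
  have hε : 16 * D ^ 2 / s ^ 2 = 16 * (D / s) ^ 2 := by ring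
  have hA2 : (A.card : ℝ) ≤ 2 * (K * s) := by
    have h1 := (card_mul_sub_le_sum_missing A C).trans_lt h
    have h2 : 16 * (D / s) ^ 2 ≤ 1 / 2 := by nlinarith
    rw [hε] at h1
    have h3 : (A.card : ℝ) * (A.card - C.card) ≤ A.card * (1 / 2 * A.card) := by nlinarith
    have h4 := le_of_mul_le_mul_left h3 ha
    linarith
  have hη : 4 * (D / s) * A.card ≤ 8 * (K * D) := by
    calc 4 * (D / s) * A.card ≤ 4 * (D / s) * (2 * (K * s)) := by gcongr
      _ = 8 * (K * D) := by field_simp; norm_num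
  have := card_le_of_sum_missing_lt (X := K * s) (M := K * s + 64 * K * D) (η := 4 * (D / s)) hA
    (by positivity) (by linarith) hC (by linarith) (by
      refine h.trans_eq ?_
      ring)
  linarith

theorem containerCost_le {α : Type*} {K s L D w : ℝ} {q : ℕ} (hK : 2 ≤ K) (hs : 0 < s) (hL : 1 ≤ L)
    (hD : 0 < D) (hwL : L ≤ w) (hw2 : w ^ 2 = K * s * L) (hD3 : D ^ 3 = s ^ 2 * w * L)
    (hq1 : w / L ≤ q) (hq2 : (q : ℝ) ≤ 2 * w / L) {Y : Finset α} (hY : Real.log Y.card = L) :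
    containerCost L (K * s) (16 * D ^ 2 / s ^ 2) q Y ∅ ≤ 7 * D := by
  unfold containerCost
  have hw : 0 < w := by linarith
  have hL0 : 0 < L := by linarith
  have hX : 0 < K * s := by positivity
  have hqp : (0 : ℝ) < q := lt_of_lt_of_le (by positivity) hq1
  set ε := 16 * D ^ 2 / s ^ 2 with hε
  have hε0 : 0 < ε := by positivity
  have hg : q * L + 2 ≤ 4 * w := by
    have : q * L ≤ 2 * w := by
      calc q * L ≤ 2 * w / L * L := by gcongr
        _ = 2 * w := by field_simp
    linarith
  have hLX : L * (K * s) / q ≤ w * L := by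
    rw [div_le_iff₀ hqp]
    have : w * L * (w / L) ≤ w * L * q := by gcongr
    have h2 : w * L * (w / L) = w ^ 2 := by field_simp
    nlinarith
  rw [hY, Finset.card_empty, Nat.cast_zero, sub_zero]
  have h1 : 8 * (q * L + 2) / ε * L + (16 * (q * L + 2) / (ε * (K * s)) + 4 * L / (ε * q)) * (K * s)
      = (8 * (q * L + 2) * L + 16 * (q * L + 2) + 4 * (L * (K * s) / q)) / ε := by
    field_simp
    ring
  have h2 : 100 * (w * L) / ε ≤ 7 * D := by
    have : w * L = D ^ 3 / s ^ 2 := by rw [hD3]; field_simp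
    rw [this, div_le_iff₀ hε0, hε]
    have h3 : 7 * D * (16 * D ^ 2 / s ^ 2) = 112 * (D ^ 3 / s ^ 2) := by ring
    rw [h3]
    have : 0 ≤ D ^ 3 / s ^ 2 := by positivity
    linarith
  rw [h1]
  refine le_trans ?_ h2
  gcongr
  nlinarith

/-- The counting theorem with abstract error parameters: `D` is the error term and `x` controls
the growth of the binomial coefficient. -/
theorem card_smallSumsetFamily_le_exp {s : ℕ} {K L D x : ℝ} (hs : 0 < s) (hK : 2 ≤ K)
    (hL : 1 ≤ L) (hD1 : 1 ≤ D) (hDs : 64 * D ≤ s) (hD6 : D ^ 6 = K * s ^ 5 * L ^ 3)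
    {Y : Finset G} (hY0 : 0 < Y.card) (hY : Real.log Y.card = L) (hx : 0 ≤ x) {N : ℕ}
    (hN : N = ⌈(K * s + (betaSubgroup G (K * s + 64 * K * D) : ℝ)) / 2⌉₊) (hsN : s ≤ N)
    (hx' : (N : ℝ) + 1 ≤ Real.exp x * (N + 1 - s)) :
    ((smallSumsetFamily s (K * s) Y ∅).card : ℝ) ≤
      Real.exp (x * (9 * K * D) + 7 * D) * N.choose s := by
  have hsr : (0 : ℝ) < s := by exact_mod_cast hs
  have hL0 : 0 < L := by linarith
  have hX : 0 < K * s := by positivity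
  have hD : 0 < D := by linarith
  set w := Real.sqrt (K * s * L) with hw
  have hw2 : w ^ 2 = K * s * L := Real.sq_sqrt (by positivity)
  have hw0 : 0 ≤ w := Real.sqrt_nonneg _
  have hD3 : D ^ 3 = s ^ 2 * w * L := by
    refine (pow_left_inj₀ (by positivity) (by positivity) two_ne_zero).1 ?_
    calc (D ^ 3) ^ 2 = D ^ 6 := by ring
      _ = s ^ 4 * (K * s * L) * L ^ 2 := by rw [hD6]; ring
      _ = (s ^ 2 * w * L) ^ 2 := by rw [← hw2]; ring
  have hLs : L ≤ K * s := by
    have h1 : D ^ 6 ≤ (s : ℝ) ^ 6 := by gcongr; linarith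
    rw [hD6] at h1
    have h2 : (s : ℝ) ^ 5 * (K * L ^ 3) ≤ s ^ 5 * s := by nlinarith
    have h3 := le_of_mul_le_mul_left h2 (by positivity)
    have h4 : L ≤ L ^ 3 := le_self_pow₀ hL (by norm_num)
    nlinarith
  have hwL : L ≤ w := Real.le_sqrt_of_sq_le (by nlinarith)
  have hwp : 0 < w := by linarith
  set q := ⌈w / L⌉₊ with hq
  have hq1 : w / L ≤ q := Nat.le_ceil _
  have h1w : 1 ≤ w / L := by rwa [one_le_div hL0]
  have hq2 : (q : ℝ) ≤ 2 * w / L := by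
    have : (q : ℝ) < w / L + 1 := Nat.ceil_lt_add_one (by positivity)
    rw [mul_div_assoc]
    linarith
  have hq0 : 0 < q := Nat.ceil_pos.2 (by positivity)
  have hqX : (q : ℝ) ≤ 3 * (16 * D ^ 2 / s ^ 2) / 16 * (K * s) := by
    refine hq2.trans ?_
    have e1 : 2 * w / L = D ^ 2 / s * (2 * D / (s * L ^ 2)) := by
      have : w = D ^ 3 / (s ^ 2 * L) := by rw [hD3]; field_simp
      rw [this]
      field_simp
    have e2 : 3 * (16 * D ^ 2 / s ^ 2) / 16 * (K * s) = D ^ 2 / s * (3 * K) := by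
      field_simp
    rw [e1, e2]
    gcongr
    rw [div_le_iff₀ (by positivity)]
    have : 1 ≤ L ^ 2 := one_le_pow₀ hL
    nlinarith
  set B := Real.exp (x * (9 * K * D)) * N.choose s with hB
  have hmain := card_smallSumsetFamily_le (Y := Y) (s := s) (q := q) (X := K * s)
    (ε := 16 * D ^ 2 / s ^ 2) (B := B) hY0 hs hX (by positivity) hq0 hqX (by positivity)
    (by
      intro A C hC hterm
      refine choose_le_exp_mul_choose hsN hx (by positivity) hx' ?_
      refine (card_le_of_terminal hsr hK hD1 hDs hC hterm).trans ?_
      gcongr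
      rw [hN]
      exact Nat.le_ceil _) Y ∅ subset_rfl
  rw [hY] at hmain
  refine hmain.trans ?_
  have hcost := containerCost_le hK hsr hL hD hwL hw2 hD3 hq1 hq2 hY
  calc B * Real.exp (containerCost L (K * s) (16 * D ^ 2 / s ^ 2) q Y ∅)
      ≤ B * Real.exp (7 * D) := by gcongr
    _ = _ := by rw [hB, Real.exp_add]; ring

/-- The two admissible growth rates `x` for the binomial coefficient, and the resulting
exponents. -/
theorem exists_growth_rate {s N : ℕ} {K D : ℝ} (hs : 21 ≤ s) (hlog : 3 ≤ Real.log s)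
    (hK : 2 ≤ K) (hD : 0 < D) (hN1 : K * s / 2 ≤ N) (hN2 : (N : ℝ) + 1 ≤ 3 / 2 * (K * s) + 2) :
    ∃ x : ℝ, 0 ≤ x ∧ (N : ℝ) + 1 ≤ Real.exp x * (N + 1 - s) ∧ x * (9 * K * D) + 7 * D ≤
      2 ^ 9 * (if K = 2 then Real.log s else min (K / (K - 2)) (Real.log s)) * D := by
  have hsr : (21 : ℝ) ≤ s := by exact_mod_cast hs
  have hlogcase : K ≤ 3 → ∃ x : ℝ, 0 ≤ x ∧ (N : ℝ) + 1 ≤ Real.exp x * (N + 1 - s) ∧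
      x * (9 * K * D) + 7 * D ≤ 2 ^ 9 * Real.log s * D := by
    intro hK3
    refine ⟨2 * Real.log s, by positivity, ?_, ?_⟩
    · have h1 : Real.exp (2 * Real.log s) = (s : ℝ) ^ 2 := by
        rw [two_mul, Real.exp_add, Real.exp_log (by linarith)]; ring
      rw [h1]
      have h2 : (1 : ℝ) ≤ N + 1 - s := by nlinarith
      have h3 : (N : ℝ) + 1 ≤ s ^ 2 := by nlinarith
      nlinarith
    · have h1 : 2 * Real.log s * (9 * K * D) ≤ 54 * (Real.log s * D) := by
        have : 0 ≤ Real.log s * D := by positivity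
        nlinarith
      nlinarith
  by_cases hK2 : K = 2
  · rw [if_pos hK2]
    exact hlogcase (by linarith)
  rw [if_neg hK2]
  have hK2' : 0 < K - 2 := by
    have := lt_of_le_of_ne hK (Ne.symm hK2)
    linarith
  rcases le_total (K / (K - 2)) (Real.log s) with h | h
  · rw [min_eq_left h]
    refine ⟨2 / (K - 2), by positivity, ?_, ?_⟩
    · have h1 : K / (K - 2) ≤ Real.exp (2 / (K - 2)) := by
        have h2 : K / (K - 2) = 2 / (K - 2) + 1 := by field_simp; ring
        rw [h2]
        exact Real.add_one_le_exp _
      have h3 : (0 : ℝ) ≤ N + 1 - s := by nlinarith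
      refine le_trans ?_ (mul_le_mul_of_nonneg_right h1 h3)
      rw [div_mul_eq_mul_div, le_div_iff₀ hK2']
      nlinarith
    · have h1 : 1 ≤ K / (K - 2) := by rw [one_le_div hK2']; linarith
      have h2 : 2 / (K - 2) * (9 * K * D) = 18 * (K / (K - 2)) * D := by field_simp; norm_num
      rw [h2]
      nlinarith
  · rw [min_eq_right h]
    refine hlogcase ?_
    have h1 : 3 ≤ K / (K - 2) := hlog.trans h
    rw [le_div_iff₀ hK2'] at h1
    linarith

end Parameters

/-- Let `s, n ≥ 2` be integers, `2 ≤ K < 2^(-36)·s/(log n)^3`, and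
`Y ⊆ G` with `|Y| = n`. The number of sets `J ⊆ Y` with `|J| = s` and `|J+J| ≤ K|J|`
is at most `exp(2^9·λ·K^(1/6)·s^(5/6)·√(log n)) · binom(⌈(Ks+β)/2⌉, s)`, where
`β = β(Ks + 2^6·K^(7/6)·s^(5/6)·√(log n))` and `λ = log s` if `K = 2`,
`λ = min{K/(K-2), log s}` if `K > 2`. -/
theorem number_of_sets_with_small_doubling_quantitative
    {G : Type*} [AddCommGroup G] [DecidableEq G]
    (s n : ℕ) (hs : 2 ≤ s) (hn : 2 ≤ n)
    (K : ℝ) (hK2 : 2 ≤ K) (hKs : K < (2 : ℝ) ^ (-36 : ℤ) * s / (Real.log n) ^ 3)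
    (Y : Finset G) (hY : Y.card = n) :
    (Nat.card {J : Finset G | J ⊆ Y ∧ J.card = s ∧
        ((J + J).card : ℝ) ≤ K * J.card} : ℝ) ≤
      Real.exp (2 ^ 9 * (if K = 2 then Real.log s else min (K / (K - 2)) (Real.log s)) *
          K ^ ((1 : ℝ) / 6) * (s : ℝ) ^ ((5 : ℝ) / 6) * Real.sqrt (Real.log n)) *
        (Nat.choose ⌈(K * s + (betaSubgroup G (K * s +
            2 ^ 6 * K ^ ((7 : ℝ) / 6) * (s : ℝ) ^ ((5 : ℝ) / 6) * Real.sqrt (Real.log n)) : ℝ))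
            / 2⌉₊ s : ℝ) := by
  have hsr : (2 : ℝ) ≤ s := by exact_mod_cast hs
  have hs0 : (0 : ℝ) < s := by linarith
  have hK0 : 0 < K := by linarith
  have hnr : (2 : ℝ) ≤ n := by exact_mod_cast hn
  have hset : {J : Finset G | J ⊆ Y ∧ J.card = s ∧ ((J + J).card : ℝ) ≤ K * J.card} =
      (smallSumsetFamily s (K * s) Y ∅ : Set (Finset G)) := by
    ext J
    simp only [Set.mem_ofPred_eq, Finset.mem_coe, mem_smallSumsetFamily, Finset.empty_subset,
      and_true, and_assoc]
    refine and_congr_right fun _ => and_congr_right fun h => ?_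
    rw [h]
  rw [Nat.card_coe_set_eq, hset, Set.ncard_coe_finset]
  rcases lt_or_ge n s with hns | hsn
  · have h0 : (smallSumsetFamily s (K * s) Y ∅).card = 0 := by
      have := card_smallSumsetFamily_le_choose s (K * s) Y ∅
      rw [hY, Nat.choose_eq_zero_of_lt hns] at this
      omega
    rw [h0, Nat.cast_zero]
    positivity
  set L := Real.log n with hLdef
  have hL2 : 1 / 2 ≤ L := by
    have := Real.log_le_log two_pos hnr
    linarith [Real.log_two_gt_d9]
  have hKL : 2 ^ 36 * (K * L ^ 3) < s := by
    rw [lt_div_iff₀ (by positivity)] at hKs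
    have h1 : (2 : ℝ) ^ (-36 : ℤ) * s = s / 2 ^ 36 := by
      rw [zpow_neg, inv_mul_eq_div]; norm_cast
    rw [h1, lt_div_iff₀ (by positivity)] at hKs
    linarith
  have hs27 : (27 : ℝ) ≤ s := by
    have h1 : (1 / 2 : ℝ) ^ 3 ≤ L ^ 3 := by gcongr
    nlinarith
  have hlog3 : 3 ≤ Real.log s := by
    rw [Real.le_log_iff_exp_le hs0]
    refine le_trans ?_ hs27
    have h1 : Real.exp 3 = Real.exp 1 ^ 3 := by rw [← Real.exp_nat_mul]; norm_num
    rw [h1]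
    calc Real.exp 1 ^ 3 ≤ 3 ^ 3 := by
          gcongr
          linarith [Real.exp_one_lt_d9]
      _ = 27 := by norm_num
  have hL1 : 1 ≤ L := by
    have : Real.log s ≤ L := Real.log_le_log hs0 (by exact_mod_cast hsn)
    linarith
  set D := K ^ ((1 : ℝ) / 6) * (s : ℝ) ^ ((5 : ℝ) / 6) * Real.sqrt L with hD
  have hDpos : 0 < D := by positivity
  have hD6 : D ^ 6 = K * s ^ 5 * L ^ 3 := by
    rw [hD, mul_pow, mul_pow, ← Real.rpow_natCast (K ^ _), ← Real.rpow_mul hK0.le,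
      ← Real.rpow_natCast ((s : ℝ) ^ _), ← Real.rpow_mul hs0.le,
      show Real.sqrt L ^ 6 = (Real.sqrt L ^ 2) ^ 3 by ring, Real.sq_sqrt (by linarith)]
    norm_num
  have hD1 : 1 ≤ D := by
    rw [← one_le_pow_iff_of_nonneg hDpos.le (by norm_num : 6 ≠ 0), hD6]
    have h1 : (1 : ℝ) ≤ (s : ℝ) ^ 5 := one_le_pow₀ (by linarith)
    have h2 : 1 ≤ L ^ 3 := one_le_pow₀ hL1
    have h3 : 1 ≤ K := by linarith
    exact one_le_mul_of_one_le_of_one_le (one_le_mul_of_one_le_of_one_le h3 h1) h2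
  have hDs : 64 * D ≤ s := by
    refine (pow_le_pow_iff_left₀ (by positivity) hs0.le (by norm_num : 6 ≠ 0)).1 ?_
    rw [mul_pow, hD6]
    calc (64 : ℝ) ^ 6 * (K * (s : ℝ) ^ 5 * L ^ 3) = (2 ^ 36 * (K * L ^ 3)) * (s : ℝ) ^ 5 := by ring
      _ ≤ (s : ℝ) * (s : ℝ) ^ 5 := by gcongr
      _ = (s : ℝ) ^ 6 := by ring
  have hM : K * s + 2 ^ 6 * K ^ ((7 : ℝ) / 6) * (s : ℝ) ^ ((5 : ℝ) / 6) * Real.sqrt L =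
      K * s + 64 * K * D := by
    have h1 : K ^ ((7 : ℝ) / 6) = K * K ^ ((1 : ℝ) / 6) := by
      rw [show (7 : ℝ) / 6 = 1 + 1 / 6 by norm_num, Real.rpow_add hK0, Real.rpow_one]
    rw [h1, hD]
    ring
  rw [hM]
  set N := ⌈(K * s + (betaSubgroup G (K * s + 64 * K * D) : ℝ)) / 2⌉₊ with hN
  have hβ0 : (0 : ℝ) ≤ betaSubgroup G (K * s + 64 * K * D) := by positivity
  have hβ : (betaSubgroup G (K * s + 64 * K * D) : ℝ) ≤ K * s + 64 * K * D :=
    betaSubgroup_le (by positivity)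
  have hN1 : K * s / 2 ≤ N := by
    refine le_trans ?_ (Nat.le_ceil _)
    linarith
  have hN2 : (N : ℝ) + 1 ≤ 3 / 2 * (K * s) + 2 := by
    have h1 : (N : ℝ) < (K * s + (betaSubgroup G (K * s + 64 * K * D) : ℝ)) / 2 + 1 :=
      Nat.ceil_lt_add_one (by positivity)
    have h2 : 64 * K * D ≤ K * s := by nlinarith
    linarith
  have hsN : s ≤ N := by
    have : (s : ℝ) ≤ N := by nlinarith
    exact_mod_cast this
  obtain ⟨x, hx, hx', hxD⟩ := exists_growth_rate (s := s) (N := N) (K := K) (D := D)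
    (by exact_mod_cast (by linarith : (21 : ℝ) ≤ s)) hlog3 hK2 hDpos hN1 hN2
  refine (card_smallSumsetFamily_le_exp (by omega) hK2 hL1 hD1 hDs hD6 (by omega)
    (by rw [hY]) hx hN hsN hx').trans ?_
  gcongr
  refine hxD.trans_eq ?_
  rw [hD]
  ring
end

section
/- Let s and n ≥ 2 be integers and let K be a real number with 2 ≤ K ≤ s/(2^{120}·(log n)^3). Let N be the number of sets J ⊆ [n] with |J| = s and |J+J| ≤ K·s, and let N' be the number of such sets J for which there exists T ⊆ J with |T| ≤ 2^{15}·K^{1/6}·s^{5/6}·√(log n) such that J∖T is contained in an arithmetic progression of size at most Ks/2 + 2^{17}·K^{7/6}·s^{5/6}·√(log n). Then N − N' ≤ exp(−K^{1/6}·s^{5/6}·√(log n)) · N. -/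
open Pointwise

theorem exists_addSubgroup_coe_eq_sub {G : Type*} [AddCommGroup G] [DecidableEq G]
    (E : Finset G) (hE : E.Nonempty) (β : ℝ) (h2β : 2 * β < E.card)
    (h : ∀ a ∈ E, ∀ b ∈ E,
      (E.card : ℝ) - β ≤ ((E.filter (fun u => u + (b - a) ∈ E)).card : ℝ)) :
    ∃ H : AddSubgroup G, (H : Set G) = ((E - E : Finset G) : Set G) ∧
      ((E - E).card : ℝ) * (E.card - β) ≤ (E.card : ℝ) ^ 2 := by
  have hsub : ∀ z ∈ E - E,
      (E.card : ℝ) - β ≤ ((E.filter (fun u => u + z ∈ E)).card : ℝ) := by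
    intro z hz
    obtain ⟨b, hb, a, ha, rfl⟩ := Finset.mem_sub.1 hz
    exact h a ha b hb
  have hneg : ∀ z ∈ E - E, -z ∈ E - E := by
    intro z hz
    obtain ⟨b, hb, a, ha, rfl⟩ := Finset.mem_sub.1 hz
    rw [neg_sub]
    exact Finset.sub_mem_sub ha hb
  have hadd : ∀ y ∈ E - E, ∀ z ∈ E - E, y + z ∈ E - E := by
    intro y hy z hz
    have h1 := hsub y hy
    have h2 := hsub (-z) (hneg z hz)
    set P := E.filter (fun u => u + y ∈ E)
    set Q := E.filter (fun u => u + -z ∈ E)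
    have hU : (P ∪ Q).card ≤ E.card :=
      Finset.card_le_card (Finset.union_subset (Finset.filter_subset _ _)
        (Finset.filter_subset _ _))
    have hI := Finset.card_union_add_card_inter P Q
    have hpos : 0 < (P ∩ Q).card := by
      by_contra h0
      have : (P.card : ℝ) + Q.card ≤ E.card := by
        exact_mod_cast (by omega : P.card + Q.card ≤ E.card)
      linarith
    obtain ⟨u, hu⟩ := Finset.card_pos.1 hpos
    rw [Finset.mem_inter, Finset.mem_filter, Finset.mem_filter] at hu
    have : y + z = (u + y) - (u + -z) := by abel
    rw [this]
    exact Finset.sub_mem_sub hu.1.2 hu.2.2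
  obtain ⟨x, hx⟩ := hE
  refine ⟨⟨⟨⟨((E - E : Finset G) : Set G), fun {a b} ha hb => ?_⟩, ?_⟩, fun {a} ha => ?_⟩, rfl, ?_⟩
  · exact hadd a ha b hb
  · exact Finset.mem_coe.2 (by simpa using Finset.sub_mem_sub hx hx)
  · exact hneg a ha
  · have hmap : ∀ p ∈ E ×ˢ E, p.2 - p.1 ∈ E - E := by
      intro p hp
      rw [Finset.mem_product] at hp
      exact Finset.sub_mem_sub hp.2 hp.1
    have hc := Finset.card_eq_sum_card_fiberwise hmap
    rw [Finset.card_product] at hc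
    have hge : ∀ z ∈ E - E, (E.card : ℝ) - β ≤
        (((E ×ˢ E).filter (fun p => p.2 - p.1 = z)).card : ℝ) := by
      intro z hz
      refine (hsub z hz).trans ?_
      norm_cast
      refine Finset.card_le_card_of_injOn (fun u => (u, u + z)) ?_ ?_
      · intro u hu
        simp only [Finset.coe_filter, Set.mem_ofPred_eq] at hu
        simp [hu.1, hu.2]
      · intro u _ v _ huv
        exact (Prod.mk.inj huv).1
    have := Finset.sum_le_sum hge
    rw [Finset.sum_const, nsmul_eq_mul] at this
    refine this.trans (le_of_eq ?_)
    rw [sq]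
    exact_mod_cast hc.symm

theorem exists_progression_of_card_le (A B : Finset ℤ) (m γ e : ℝ) (hB : (B.card : ℝ) ≤ m)
    (hA : 2 ≤ A.card) (he : e = A.card - 1)
    (hdeg : ∀ a ∈ A, ((A.filter (fun b => a + b ∉ B)).card : ℝ) ≤ γ)
    (hβ : 2 * (m + 4 * γ - 2 * e) < e) :
    2 * e ≤ m + 3 * γ ∧ ∃ a d : ℤ, d ≠ 0 ∧ ∃ L : ℕ, (L : ℝ) ≤ 2 * m + 8 * γ - 3 * e + 1 ∧
      A ⊆ (Finset.range L).image (fun i : ℕ => a + (i : ℤ) * d) := by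
  have hne : A.Nonempty := Finset.card_pos.1 (by omega)
  obtain ⟨x, y, hx, hy, hxA, hAy, hxy⟩ : ∃ x y, x ∈ A ∧ y ∈ A ∧ (∀ a ∈ A, x ≤ a) ∧
      (∀ a ∈ A, a ≤ y) ∧ x < y :=
    ⟨A.min' hne, A.max' hne, A.min'_mem hne, A.max'_mem hne, fun a ha => A.min'_le a ha,
      fun a ha => A.le_max' a ha, A.min'_lt_max'_of_card (by omega)⟩
  obtain ⟨ℓ, hℓ⟩ : ∃ ℓ : ℕ, (ℓ : ℤ) = y - x := ⟨(y - x).toNat, by omega⟩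
  have hℓpos : 0 < ℓ := by omega
  have : NeZero ℓ := ⟨hℓpos.ne'⟩
  set E := A.erase y with hE
  have hEcard : (E.card : ℝ) = e := by
    rw [hE, Finset.card_erase_of_mem hy, he, Nat.cast_sub (by omega)]; simp
  have hEA : E ⊆ A := Finset.erase_subset _ _
  have hEy : ∀ a ∈ E, a < y := fun a ha =>
    lt_of_le_of_ne (hAy a (hEA ha)) (Finset.ne_of_mem_erase ha)
  have hxE : x ∈ E := Finset.mem_erase.2 ⟨hxy.ne, hx⟩
  let π : ℤ → ZMod ℓ := fun z => (z : ZMod ℓ)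
  have hπ : ∀ a b : ℤ, π a = π b ↔ (ℓ : ℤ) ∣ b - a := fun a b =>
    ZMod.intCast_eq_intCast_iff_dvd_sub a b ℓ
  have hinj : Set.InjOn π E := by
    intro a ha b hb hab
    rw [hπ, hℓ] at hab
    have h1 := hEy a ha
    have h2 := hEy b hb
    have h3 := hxA a (hEA ha)
    have h4 := hxA b (hEA hb)
    have := Int.eq_zero_of_abs_lt_dvd hab (by rw [abs_lt]; constructor <;> omega)
    omega
  have hyx : π y = π x := by rw [hπ, hℓ]; exact ⟨-1, by ring⟩
  set C := B.image π with hC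
  have hgood : ∀ a ∈ A, e - γ ≤ ((E.filter (fun b => a + b ∈ B)).card : ℝ) := by
    intro a ha
    have h1 := Finset.card_filter_add_card_filter_not (s := E) (fun b => a + b ∈ B)
    have h2 : (E.filter (fun b => a + b ∉ B)).card ≤ (A.filter (fun b => a + b ∉ B)).card :=
      Finset.card_le_card (Finset.filter_subset_filter _ hEA)
    have h3 := hdeg a ha
    have h4 : ((E.filter (fun b => a + b ∈ B)).card : ℝ) +
      (E.filter (fun b => a + b ∉ B)).card = E.card := by exact_mod_cast h1
    have h5 : ((E.filter (fun b => a + b ∉ B)).card : ℝ) ≤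
      (A.filter (fun b => a + b ∉ B)).card := by exact_mod_cast h2
    linarith
  -- Reducing modulo `ℓ` identifies `x + a` with `y + a`.
  have hCle : (C.card : ℝ) ≤ m - e + 2 * γ := by
    set P := E.filter (fun b => x + b ∈ B)
    set P' := E.filter (fun b => y + b ∈ B)
    set Q := (P ∩ P').image (fun b => y + b) with hQ
    have hQB : Q ⊆ B := by
      intro z hz
      obtain ⟨b, hb, rfl⟩ := Finset.mem_image.1 hz
      exact (Finset.mem_filter.1 (Finset.mem_inter.1 hb).2).2
    have hQcard : Q.card = (P ∩ P').card :=
      Finset.card_image_of_injective _ (add_right_injective y)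
    have hCQ : C ⊆ (B \ Q).image π := by
      intro c hc
      obtain ⟨b, hb, rfl⟩ := Finset.mem_image.1 hc
      by_cases hbQ : b ∈ Q
      · obtain ⟨a, ha, rfl⟩ := Finset.mem_image.1 hbQ
        have ha1 := (Finset.mem_filter.1 (Finset.mem_inter.1 ha).1)
        refine Finset.mem_image.2 ⟨x + a, Finset.mem_sdiff.2 ⟨ha1.2, fun hQ' => ?_⟩, ?_⟩
        · obtain ⟨a', ha', haa⟩ := Finset.mem_image.1 hQ'
          have h1 := (Finset.mem_filter.1 (Finset.mem_inter.1 ha').1).1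
          have h2 := hxA a' (hEA h1)
          have h3 := hEy a ha1.1
          omega
        · rw [hπ, hℓ]; exact ⟨1, by ring⟩
      · exact Finset.mem_image.2 ⟨b, Finset.mem_sdiff.2 ⟨hb, hbQ⟩, rfl⟩
    have h1 : C.card ≤ (B \ Q).card := (Finset.card_le_card hCQ).trans Finset.card_image_le
    have h2 := Finset.card_sdiff_add_card_eq_card hQB
    have h3 := Finset.card_union_add_card_inter P P'
    have h4 : (P ∪ P').card ≤ E.card := Finset.card_le_card
      (Finset.union_subset (Finset.filter_subset _ _) (Finset.filter_subset _ _))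
    have h5 : (C.card : ℝ) + P.card + P'.card ≤ B.card + E.card := by
      exact_mod_cast (by omega : C.card + P.card + P'.card ≤ B.card + E.card)
    have h6 := hgood x hx
    have h7 := hgood y hy
    linarith
  let R : ℤ → Finset (ZMod ℓ) := fun a => (E.filter (fun b => a + b ∈ B)).image (fun b => π (a + b))
  have hRC : ∀ a, R a ⊆ C := by
    intro a z hz
    obtain ⟨b, hb, rfl⟩ := Finset.mem_image.1 hz
    exact Finset.mem_image.2 ⟨_, (Finset.mem_filter.1 hb).2, rfl⟩
  have hRcard : ∀ a ∈ A, e - γ ≤ (R a).card := by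
    intro a ha
    refine (hgood a ha).trans (le_of_eq ?_)
    congr 1
    symm
    refine Finset.card_image_of_injOn ?_
    intro u hu v hv huv
    apply hinj (Finset.mem_filter.1 hu).1 (Finset.mem_filter.1 hv).1
    simpa [π] using huv
  have hfirst : 2 * e ≤ m + 3 * γ := by
    have h1 := hRcard x hx
    have h2 : ((R x).card : ℝ) ≤ C.card := by exact_mod_cast Finset.card_le_card (hRC x)
    linarith
  refine ⟨hfirst, ?_⟩
  set F := E.image π with hF
  have hFcard : (F.card : ℝ) = e := by
    rw [hF, Finset.card_image_of_injOn hinj, hEcard]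
  set β := m + 4 * γ - 2 * e with hβdef
  have hpop : ∀ a ∈ F, ∀ b ∈ F,
      (F.card : ℝ) - β ≤ ((F.filter (fun u => u + (b - a) ∈ F)).card : ℝ) := by
    intro a' ha' b' hb'
    obtain ⟨a, ha, rfl⟩ := Finset.mem_image.1 ha'
    obtain ⟨b, hb, rfl⟩ := Finset.mem_image.1 hb'
    have h1 := hRcard a (hEA ha)
    have h2 := hRcard b (hEA hb)
    have h3 : (R a ∪ R b).card ≤ C.card :=
      Finset.card_le_card (Finset.union_subset (hRC a) (hRC b))
    have h4 := Finset.card_union_add_card_inter (R a) (R b)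
    have h5 : ((R a).card : ℝ) + (R b).card ≤ C.card + (R a ∩ R b).card := by
      exact_mod_cast (by omega : (R a).card + (R b).card ≤ C.card + (R a ∩ R b).card)
    have h6 : (R a ∩ R b).card ≤ (F.filter (fun u => u + (π b - π a) ∈ F)).card := by
      refine Finset.card_le_card_of_injOn (fun u => u - π b) ?_ ?_
      · intro u hu
        obtain ⟨hu1, hu2⟩ := Finset.mem_inter.1 hu
        obtain ⟨v, hv, hv'⟩ := Finset.mem_image.1 hu1
        obtain ⟨w, hw, hw'⟩ := Finset.mem_image.1 hu2
        have e1 : u - π b = π w := by rw [← hw']; simp [π]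
        have e2 : u - π b + (π b - π a) = π v := by rw [← hv']; simp [π]
        refine Finset.mem_coe.2 (Finset.mem_filter.2 ⟨?_, ?_⟩)
        · simp only [e1]
          exact Finset.mem_image_of_mem _ (Finset.mem_filter.1 hw).1
        · simp only [e2]
          exact Finset.mem_image_of_mem _ (Finset.mem_filter.1 hv).1
      · intro u _ v _ huv
        exact sub_left_injective huv
    have h7 : ((R a ∩ R b).card : ℝ) ≤ (F.filter (fun u => u + (π b - π a) ∈ F)).card := by
      exact_mod_cast h6
    rw [hFcard]
    linarith
  have hFne : F.Nonempty := ⟨_, Finset.mem_image_of_mem π hxE⟩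
  obtain ⟨H, hH, hHcard⟩ := exists_addSubgroup_coe_eq_sub F hFne β (by rw [hFcard]; linarith) hpop
  have hβ0 : 0 ≤ β := by
    obtain ⟨a, ha⟩ := hFne
    have h1 := hpop a ha a ha
    have h2 : ((F.filter (fun u => u + (a - a) ∈ F)).card : ℝ) ≤ F.card := by
      exact_mod_cast Finset.card_filter_le _ _
    linarith
  have hmemH : ∀ z, z ∈ H ↔ z ∈ F - F := fun z => by
    rw [← SetLike.mem_coe, hH, Finset.mem_coe]
  obtain ⟨d, hd⟩ := Int.subgroup_cyclic (H.comap (Int.castAddHom (ZMod ℓ)))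
  have hdmem : ∀ z : ℤ, π z ∈ H ↔ d ∣ z := by
    intro z
    have : z ∈ H.comap (Int.castAddHom (ZMod ℓ)) ↔ d ∣ z := by
      rw [hd, ← AddSubgroup.zmultiples_eq_closure, Int.mem_zmultiples_iff]
    rw [← this]; rfl
  have hdℓ : d ∣ (ℓ : ℤ) := by
    rw [← hdmem]
    have : π (ℓ : ℤ) = 0 := by simp [π]
    rw [this]; exact H.zero_mem
  obtain ⟨D, hD⟩ : ∃ D : ℕ, D = d.natAbs := ⟨_, rfl⟩
  have hDdvd : ∀ z : ℤ, π z ∈ H ↔ (D : ℤ) ∣ z := by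
    intro z; rw [hdmem, hD, Int.natCast_natAbs, abs_dvd]
  obtain ⟨l, hl⟩ : D ∣ ℓ := by
    have := (hDdvd ℓ).1 ((hdmem ℓ).2 hdℓ)
    exact_mod_cast this
  have hDpos : 0 < D := Nat.pos_of_ne_zero (by rintro rfl; simp at hl; omega)
  have hlcard : l ≤ (F - F).card := by
    have : ((Finset.range l).image (fun i : ℕ => π ((i : ℤ) * D))).card = l := by
      rw [Finset.card_image_of_injOn, Finset.card_range]
      intro i hi j hj hij
      simp only [Finset.coe_range, Set.mem_Iio] at hi hj
      simp only at hij
      rw [hπ, hl] at hij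
      rw [← sub_mul, mul_comm D l] at hij
      push_cast at hij
      have := Int.dvd_of_mul_dvd_mul_right (by exact_mod_cast hDpos.ne') hij
      have := Int.eq_zero_of_abs_lt_dvd this (by rw [abs_lt]; constructor <;> omega)
      omega
    rw [← this]
    refine Finset.card_le_card ?_
    intro z hz
    obtain ⟨i, _, rfl⟩ := Finset.mem_image.1 hz
    rw [← hmemH, hDdvd]
    exact dvd_mul_left _ _
  have hepos : 0 < e - β := by linarith
  have hlle : (l : ℝ) ≤ e + 2 * β := by
    have h1 : (l : ℝ) ≤ (F - F).card := by exact_mod_cast hlcard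
    rw [hFcard] at hHcard
    have h2 : (l : ℝ) * (e - β) ≤ (e + 2 * β) * (e - β) := by
      nlinarith
    exact le_of_mul_le_mul_right h2 hepos
  refine ⟨x, D, by exact_mod_cast hDpos.ne', l + 1, ?_, ?_⟩
  · push_cast; linarith
  · intro a ha
    have hdvd : (D : ℤ) ∣ a - x := by
      rw [← hDdvd, hmemH]
      have : π (a - x) = π a - π x := by simp [π]
      rw [this]
      refine Finset.sub_mem_sub ?_ (Finset.mem_image_of_mem _ hxE)
      by_cases hay : a = y
      · rw [hay, hyx]; exact Finset.mem_image_of_mem _ hxE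
      · exact Finset.mem_image_of_mem _ (Finset.mem_erase.2 ⟨hay, ha⟩)
    obtain ⟨i, hi⟩ := hdvd
    have h1 := hxA a ha
    have h2 := hAy a ha
    have hDz : (0 : ℤ) < D := by exact_mod_cast hDpos
    have hi0 : 0 ≤ i := by nlinarith
    have hil : i ≤ l := by
      have : (D : ℤ) * i ≤ D * l := by
        rw [← hi, ← Nat.cast_mul, ← hl]; omega
      exact le_of_mul_le_mul_left this hDz
    refine Finset.mem_image.2 ⟨i.toNat, Finset.mem_range.2 (by omega), ?_⟩
    rw [Int.toNat_of_nonneg hi0]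
    linarith

/-- The pairs of elements of `A` whose sum lies outside `B`. -/
def missingPairs (A B : Finset ℤ) : Finset (ℤ × ℤ) :=
  (A ×ˢ A).filter (fun p => p.1 + p.2 ∉ B)

theorem sum_card_filter_comm {α β : Type*} (s : Finset α) (t : Finset β) (p : α → β → Prop)
    [∀ a b, Decidable (p a b)] :
    ∑ a ∈ s, (t.filter (fun b => p a b)).card = ∑ b ∈ t, (s.filter (fun a => p a b)).card := by
  simp only [Finset.card_filter]
  exact Finset.sum_comm

theorem card_missingPairs (A B : Finset ℤ) :
    (missingPairs A B).card = ∑ a ∈ A, (A.filter (fun b => a + b ∉ B)).card := by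
  simp only [missingPairs, Finset.card_filter, Finset.sum_product]

theorem sum_powerset_inv_pow_card_le (U : Finset ℤ) (n : ℕ) (hn : 1 ≤ n) (hU : U.card ≤ n) :
    ∑ P ∈ U.powerset, ((n : ℝ)⁻¹) ^ P.card ≤ 3 := by
  have h := Finset.sum_pow_mul_eq_add_pow ((n : ℝ)⁻¹) 1 U
  simp only [one_pow, mul_one] at h
  have hn0 : (0 : ℝ) < n := by exact_mod_cast hn
  rw [h]
  calc ((n : ℝ)⁻¹ + 1) ^ U.card ≤ ((n : ℝ)⁻¹ + 1) ^ n :=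
        pow_le_pow_right₀ (by linarith [inv_pos.2 hn0]) hU
    _ ≤ (Real.exp ((n : ℝ)⁻¹)) ^ n :=
        pow_le_pow_left₀ (by positivity) (Real.add_one_le_exp _) n
    _ = Real.exp 1 := by rw [← Real.exp_nat_mul, mul_inv_cancel₀ hn0.ne']
    _ ≤ 3 := by linarith [Real.exp_one_lt_d9]

theorem card_powerset_filter_card_le (U : Finset ℤ) (n q : ℕ) (hn : 1 ≤ n) (hU : U.card ≤ n) :
    ((U.powerset.filter (fun S => S.card ≤ q)).card : ℝ) ≤ 3 * (n : ℝ) ^ q := by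
  have hn1 : (1 : ℝ) ≤ n := by exact_mod_cast hn
  calc ((U.powerset.filter (fun S => S.card ≤ q)).card : ℝ)
      = ∑ S ∈ U.powerset.filter (fun S => S.card ≤ q), (1 : ℝ) := by simp
    _ ≤ ∑ S ∈ U.powerset.filter (fun S => S.card ≤ q), (n : ℝ) ^ q * ((n : ℝ)⁻¹) ^ S.card := by
        refine Finset.sum_le_sum fun S hS => ?_
        have hS := (Finset.mem_filter.1 hS).2
        rw [inv_pow, ← div_eq_mul_inv, le_div_iff₀ (by positivity), one_mul]
        exact pow_le_pow_right₀ hn1 hS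
    _ ≤ ∑ S ∈ U.powerset, (n : ℝ) ^ q * ((n : ℝ)⁻¹) ^ S.card :=
        Finset.sum_le_sum_of_subset_of_nonneg (Finset.filter_subset _ _)
          fun _ _ _ => by positivity
    _ = (n : ℝ) ^ q * ∑ S ∈ U.powerset, ((n : ℝ)⁻¹) ^ S.card := by rw [Finset.mul_sum]
    _ ≤ (n : ℝ) ^ q * 3 := by
        gcongr
        exact sum_powerset_inv_pow_card_le U n hn hU
    _ = 3 * (n : ℝ) ^ q := by ring

theorem potential_add_one_le (η M m a a' b b' : ℝ) (hη : 0 < η) (hη1 : η ≤ 1) (hM : 0 < M)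
    (ha : M ≤ a) (ha' : M ≤ a') (haa : a' ≤ a) (hbb : b ≤ b')
    (h : a' ≤ (1 - η / 8) * a ∨ η * a / 4 ≤ b' - b) :
    8 / η * Real.log (a' / M) + (m - b') * (4 / (η * M)) + 1 ≤
      8 / η * Real.log (a / M) + (m - b) * (4 / (η * M)) := by
  have hc : 0 < 8 / η := by positivity
  have hapos : 0 < a := by linarith
  have hapos' : 0 < a' := by linarith
  have hlog : Real.log (a' / M) ≤ Real.log (a / M) :=
    Real.log_le_log (by positivity) (by gcongr)
  have hb : (m - b') * (4 / (η * M)) ≤ (m - b) * (4 / (η * M)) := by gcongr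
  rcases h with h | h
  · have h1 : Real.log (a' / M) ≤ Real.log (a / M) - η / 8 := by
      have : Real.log (a' / M) ≤ Real.log ((1 - η / 8) * (a / M)) :=
        Real.log_le_log (by positivity) (by rw [← mul_div_assoc]; gcongr)
      rw [Real.log_mul (by linarith) (by positivity)] at this
      have h2 := Real.log_le_sub_one_of_pos (show 0 < 1 - η / 8 by linarith)
      linarith
    have h2 := mul_le_mul_of_nonneg_left h1 hc.le
    have h3 : 8 / η * (η / 8) = 1 := by field_simp
    linarith
  · have h1 : 1 ≤ (b' - b) * (4 / (η * M)) := by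
      rw [mul_div_assoc', le_div_iff₀ (by positivity)]
      nlinarith
    have h2 := mul_le_mul_of_nonneg_left hlog hc.le
    linarith

/-- Either few elements of `A` have few sums with `S` outside `B'`, or `B'` is much larger
than `B`. -/
theorem card_filter_le_or_le_card_sdiff (A B B' S : Finset ℤ) (η : ℝ) (hη : 0 < η)
    (hS : 0 < S.card)
    (hdeg : ∀ v ∈ S, η * A.card / 2 ≤ ((A.filter (fun a => v + a ∉ B)).card : ℝ)) :
    ((A.filter (fun a => ((S.filter (fun v => a + v ∉ B')).card : ℝ) <
        S.card * η / 8)).card : ℝ) ≤ (1 - η / 8) * A.card ∨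
      η * A.card / 4 ≤ ((B' \ B).card : ℝ) := by
  by_contra! hcon
  obtain ⟨h1, h2⟩ := hcon
  set A' := A.filter (fun a => ((S.filter (fun v => a + v ∉ B')).card : ℝ) < S.card * η / 8)
    with hA'
  have hSpos : (0 : ℝ) < S.card := by exact_mod_cast hS
  have hvertex : ∀ v ∈ S, η * A.card / 2 ≤
      ((A.filter (fun a => a + v ∉ B')).card : ℝ) + (B' \ B).card := by
    intro v hv
    refine (hdeg v hv).trans ?_
    have hsub : A.filter (fun a => v + a ∉ B) ⊆
        A.filter (fun a => a + v ∉ B') ∪ A.filter (fun a => a + v ∈ B' \ B) := by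
      intro a ha
      simp only [Finset.mem_filter, Finset.mem_union, Finset.mem_sdiff] at ha ⊢
      rw [add_comm v a] at ha
      tauto
    have hle : (A.filter (fun a => a + v ∈ B' \ B)).card ≤ (B' \ B).card :=
      Finset.card_le_card_of_injOn (fun a => a + v)
        (fun a ha => (Finset.mem_filter.1 ha).2) (fun a _ b _ h => add_left_injective v h)
    have := (Finset.card_le_card hsub).trans (Finset.card_union_le _ _)
    exact_mod_cast this.trans (by omega)
  have hsum := Finset.sum_le_sum hvertex
  rw [Finset.sum_const, nsmul_eq_mul, Finset.sum_add_distrib, Finset.sum_const,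
    nsmul_eq_mul] at hsum
  have hdouble : ∑ v ∈ S, ((A.filter (fun a => a + v ∉ B')).card : ℝ) =
      ∑ a ∈ A, ((S.filter (fun v => a + v ∉ B')).card : ℝ) := by
    exact_mod_cast sum_card_filter_comm S A (fun v a => a + v ∉ B')
  have hsplit := Finset.sum_filter_add_sum_filter_not A
    (fun a => ((S.filter (fun v => a + v ∉ B')).card : ℝ) < S.card * η / 8)
    (fun a => ((S.filter (fun v => a + v ∉ B')).card : ℝ))
  have hfew : ∑ a ∈ A', ((S.filter (fun v => a + v ∉ B')).card : ℝ) ≤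
      A'.card * (S.card * η / 8) := by
    rw [← nsmul_eq_mul]
    exact Finset.sum_le_card_nsmul _ _ _ fun a ha => (Finset.mem_filter.1 ha).2.le
  set A'' := A.filter (fun a => ¬ ((S.filter (fun v => a + v ∉ B')).card : ℝ) < S.card * η / 8)
    with hA''
  have hmany : ∑ a ∈ A'', ((S.filter (fun v => a + v ∉ B')).card : ℝ) ≤ A''.card * S.card := by
    rw [← nsmul_eq_mul]
    exact Finset.sum_le_card_nsmul _ _ _ fun a _ => by
      exact_mod_cast Finset.card_filter_le _ _
  have hcard : (A'.card : ℝ) + A''.card = A.card := by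
    exact_mod_cast Finset.card_filter_add_card_filter_not (s := A)
      (fun a => ((S.filter (fun v => a + v ∉ B')).card : ℝ) < S.card * η / 8)
  have hA'le : (A'.card : ℝ) * (S.card * η / 8) ≤ A.card * (S.card * η / 8) :=
    mul_le_mul_of_nonneg_right (by linarith [(Nat.cast_nonneg A''.card : (0 : ℝ) ≤ _)])
      (by positivity)
  rw [← hA'] at hsplit
  nlinarith

/-- The container theorem for sets with small sumset: a potential argument in which each round
either shrinks `A` by a constant factor or enlarges `B` substantially. -/
theorem exists_containers (U : Finset ℤ) (n q : ℕ) (η M m : ℝ) (hn : 1 ≤ n) (hU : U.card ≤ n)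
    (hq : 0 < q) (hη : 0 < η) (hη1 : η ≤ 1) (hM : 0 < M) (hqM : (q : ℝ) ≤ η * M / 4) (r : ℕ) :
    ∀ A B : Finset ℤ, A ⊆ U →
      (M ≤ A.card → 8 / η * Real.log (A.card / M) + (m - B.card) * (4 / (η * M)) < r) →
      ∃ 𝒞 : Finset (Finset ℤ × Finset ℤ),
        (𝒞.card : ℝ) ≤ (12 * (n : ℝ) ^ q) ^ r * (n : ℝ) ^ (8 / (q * η) * (m - B.card)) ∧
        ∀ J : Finset ℤ, J ⊆ A → B ⊆ J + J → ((J + J).card : ℝ) ≤ m →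
          ∃ p ∈ 𝒞, J ⊆ p.1 ∧ p.2 ⊆ J + J ∧
            ((p.1.card : ℝ) < M ∨
              ((missingPairs p.1 p.2).card : ℝ) ≤ η * (p.1.card : ℝ) ^ 2) := by
  have hn1 : (1 : ℝ) ≤ n := by exact_mod_cast hn
  have hn0 : (0 : ℝ) < n := by linarith
  have hY : (1 : ℝ) ≤ 12 * (n : ℝ) ^ q := by linarith [one_le_pow₀ (n := q) hn1]
  have hc : (0 : ℝ) < 8 / (q * η) := by positivity
  induction r with
  | zero =>
    intro A B _ hpot
    by_cases hBm : m < B.card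
    · refine ⟨∅, by simp; positivity, fun J _ hBJ hJ => ?_⟩
      have : (B.card : ℝ) ≤ (J + J).card := by exact_mod_cast Finset.card_le_card hBJ
      linarith
    push Not at hBm
    have hexp : (1 : ℝ) ≤ (n : ℝ) ^ (8 / (q * η) * (m - B.card)) :=
      Real.one_le_rpow hn1 (mul_nonneg hc.le (by linarith))
    refine ⟨{(A, B)}, by simpa using hexp, fun J hJA hBJ _ => ⟨_, Finset.mem_singleton_self _,
      hJA, hBJ, Or.inl ?_⟩⟩
    by_contra! hAM
    have := hpot hAM
    have h1 : 0 ≤ Real.log (A.card / M) := Real.log_nonneg (by rwa [le_div_iff₀ hM, one_mul])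
    have h2 : 0 ≤ (m - B.card) * (4 / (η * M)) := mul_nonneg (by linarith) (by positivity)
    have h3 : 0 ≤ 8 / η * Real.log (A.card / M) := mul_nonneg (by positivity) h1
    simp at this
    linarith
  | succ r ih =>
    intro A B hAU hpot
    by_cases hBm : m < B.card
    · refine ⟨∅, by simp; positivity, fun J _ hBJ hJ => ?_⟩
      have : (B.card : ℝ) ≤ (J + J).card := by exact_mod_cast Finset.card_le_card hBJ
      linarith
    push Not at hBm
    by_cases hterm : (A.card : ℝ) < M ∨ ((missingPairs A B).card : ℝ) ≤ η * (A.card : ℝ) ^ 2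
    · have hexp : (1 : ℝ) ≤ (n : ℝ) ^ (8 / (q * η) * (m - B.card)) :=
        Real.one_le_rpow hn1 (mul_nonneg hc.le (by linarith))
      refine ⟨{(A, B)}, ?_, fun J hJA hBJ _ => ⟨_, Finset.mem_singleton_self _, hJA, hBJ, hterm⟩⟩
      simpa using one_le_mul_of_one_le_of_one_le (one_le_pow₀ (n := r + 1) hY) hexp
    push Not at hterm
    obtain ⟨hAM, hbad⟩ := hterm
    have hpot := hpot hAM
    have hA0 : (0 : ℝ) < A.card := by linarith
    have ih' : ∀ A' B' : Finset ℤ, ∃ 𝒞 : Finset (Finset ℤ × Finset ℤ),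
        (𝒞.card : ℝ) ≤ (12 * (n : ℝ) ^ q) ^ r * (n : ℝ) ^ (8 / (q * η) * (m - B'.card)) ∧
        (A' ⊆ U →
          (M ≤ A'.card → 8 / η * Real.log (A'.card / M) + (m - B'.card) * (4 / (η * M)) < r) →
          ∀ J : Finset ℤ, J ⊆ A' → B' ⊆ J + J → ((J + J).card : ℝ) ≤ m →
          ∃ p ∈ 𝒞, J ⊆ p.1 ∧ p.2 ⊆ J + J ∧ ((p.1.card : ℝ) < M ∨
              ((missingPairs p.1 p.2).card : ℝ) ≤ η * (p.1.card : ℝ) ^ 2)) := by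
      intro A' B'
      by_cases h : A' ⊆ U ∧ (M ≤ A'.card →
          8 / η * Real.log (A'.card / M) + (m - B'.card) * (4 / (η * M)) < r)
      · obtain ⟨𝒞, h1, h2⟩ := ih A' B' h.1 h.2
        exact ⟨𝒞, h1, fun _ _ => h2⟩
      · exact ⟨∅, by simp; positivity, fun h1 h2 => absurd ⟨h1, h2⟩ h⟩
    choose 𝒟 h𝒟card h𝒟 using ih'
    set H := A.filter (fun v => η * A.card / 2 ≤ ((A.filter (fun a => v + a ∉ B)).card : ℝ))
      with hH
    have hHA : H ⊆ A := Finset.filter_subset _ _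
    have hHcard : η * A.card / 2 ≤ H.card := by
      rw [card_missingPairs] at hbad
      push_cast at hbad
      rw [← Finset.sum_filter_add_sum_filter_not A
        (fun v => η * A.card / 2 ≤ ((A.filter (fun a => v + a ∉ B)).card : ℝ))] at hbad
      have h1 : ∑ a ∈ H, ((A.filter (fun b => a + b ∉ B)).card : ℝ) ≤ H.card * A.card := by
        rw [← nsmul_eq_mul]
        exact Finset.sum_le_card_nsmul _ _ _ fun a _ => by
          exact_mod_cast Finset.card_filter_le _ _
      have h2 : ∑ a ∈ A.filter (fun v => ¬ η * A.card / 2 ≤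
          ((A.filter (fun a => v + a ∉ B)).card : ℝ)), ((A.filter (fun b => a + b ∉ B)).card : ℝ)
          ≤ A.card * (η * A.card / 2) := by
        refine (Finset.sum_le_card_nsmul _ _ (η * A.card / 2)
          fun a ha => (not_le.1 (Finset.mem_filter.1 ha).2).le).trans ?_
        rw [nsmul_eq_mul]
        gcongr
        exact Finset.filter_subset _ _
      have h3 : η * A.card / 2 * A.card ≤ H.card * A.card := by nlinarith
      exact le_of_mul_le_mul_right h3 hA0
    let small : Finset ℤ → Finset ℤ → Finset ℤ := fun S B' =>
      A.filter (fun a => ((S.filter (fun v => a + v ∉ B')).card : ℝ) < S.card * η / 8)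
    let 𝒯 : Finset ℤ → Finset (Finset ℤ) := fun S => U.powerset.filter
      (fun P => (P.card : ℝ) * (q * η / 8) ≤ (((B ∪ (P + S)) \ B).card : ℝ))
    let 𝒢 : Finset ℤ → Finset (Finset ℤ × Finset ℤ) := fun S =>
      𝒟 ((A \ H) ∪ S) B ∪ (𝒯 S).biUnion (fun P => 𝒟 (small S (B ∪ (P + S))) (B ∪ (P + S)))
    set X := (12 * (n : ℝ) ^ q) ^ r * (n : ℝ) ^ (8 / (q * η) * (m - B.card)) with hX
    have hsdiff : ∀ P S : Finset ℤ, (((B ∪ (P + S)) \ B).card : ℝ) =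
        (B ∪ (P + S)).card - B.card := fun P S => by
      rw [eq_sub_iff_add_eq]
      exact_mod_cast Finset.card_sdiff_add_card_eq_card Finset.subset_union_left
    have h𝒢card : ∀ S, ((𝒢 S).card : ℝ) ≤ 4 * X := by
      intro S
      have h1 : (((𝒯 S).biUnion
          (fun P => 𝒟 (small S (B ∪ (P + S))) (B ∪ (P + S)))).card : ℝ) ≤ 3 * X := by
        have h2 : ∀ P ∈ 𝒯 S, ((𝒟 (small S (B ∪ (P + S))) (B ∪ (P + S))).card : ℝ) ≤
            X * ((n : ℝ)⁻¹) ^ P.card := by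
          intro P hP
          have hP := (Finset.mem_filter.1 hP).2
          rw [hsdiff] at hP
          refine (h𝒟card _ _).trans ?_
          rw [hX, mul_assoc]
          gcongr
          rw [inv_pow, ← Real.rpow_natCast, ← Real.rpow_neg hn0.le, ← Real.rpow_add hn0]
          refine Real.rpow_le_rpow_of_exponent_le hn1 ?_
          have h3 : (P.card : ℝ) ≤ 8 / (q * η) * ((B ∪ (P + S)).card - B.card) := by
            rw [div_mul_eq_mul_div, le_div_iff₀ (by positivity)]
            linarith
          linarith
        calc _ ≤ ∑ P ∈ 𝒯 S, ((𝒟 (small S (B ∪ (P + S))) (B ∪ (P + S))).card : ℝ) := by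
              exact_mod_cast Finset.card_biUnion_le
          _ ≤ ∑ P ∈ 𝒯 S, X * ((n : ℝ)⁻¹) ^ P.card := Finset.sum_le_sum h2
          _ ≤ ∑ P ∈ U.powerset, X * ((n : ℝ)⁻¹) ^ P.card :=
              Finset.sum_le_sum_of_subset_of_nonneg (Finset.filter_subset _ _)
                fun _ _ _ => by positivity
          _ = X * ∑ P ∈ U.powerset, ((n : ℝ)⁻¹) ^ P.card := by rw [Finset.mul_sum]
          _ ≤ X * 3 := by
              gcongr
              exact sum_powerset_inv_pow_card_le U n hn hU
          _ = 3 * X := by ring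
      have h2 := h𝒟card ((A \ H) ∪ S) B
      have h3 : ((𝒢 S).card : ℝ) ≤ (𝒟 ((A \ H) ∪ S) B).card + ((𝒯 S).biUnion
          (fun P => 𝒟 (small S (B ∪ (P + S))) (B ∪ (P + S)))).card := by
        exact_mod_cast Finset.card_union_le _ _
      linarith
    refine ⟨(U.powerset.filter (fun S => S.card ≤ q)).biUnion 𝒢, ?_, ?_⟩
    · calc (((U.powerset.filter (fun S => S.card ≤ q)).biUnion 𝒢).card : ℝ)
          ≤ ∑ S ∈ U.powerset.filter (fun S => S.card ≤ q), ((𝒢 S).card : ℝ) := by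
            exact_mod_cast Finset.card_biUnion_le
        _ ≤ (U.powerset.filter (fun S => S.card ≤ q)).card * (4 * X) := by
            rw [← nsmul_eq_mul]
            exact Finset.sum_le_card_nsmul _ _ _ fun S _ => h𝒢card S
        _ ≤ (3 * (n : ℝ) ^ q) * (4 * X) := by
            gcongr
            exact card_powerset_filter_card_le U n q hn hU
        _ = _ := by rw [hX, pow_succ]; ring
    · intro J hJA hBJ hJm
      have hJU : J ⊆ U := hJA.trans hAU
      by_cases hJH : (J ∩ H).card < q
      · have hsub : (A \ H) ∪ (J ∩ H) ⊆ A := Finset.union_subset Finset.sdiff_subset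
          (Finset.inter_subset_left.trans hJA)
        have hcov : J ⊆ (A \ H) ∪ (J ∩ H) := by
          intro x hx
          have := hJA hx
          simp only [Finset.mem_union, Finset.mem_sdiff, Finset.mem_inter]
          tauto
        obtain ⟨p, hp, hp'⟩ := h𝒟 ((A \ H) ∪ (J ∩ H)) B (hsub.trans hAU) (fun hM' => by
          have hlt : (((A \ H) ∪ (J ∩ H)).card : ℝ) ≤ (1 - η / 8) * A.card := by
            have h1 : (((A \ H) ∪ (J ∩ H)).card : ℝ) ≤ (A \ H).card + (J ∩ H).card := by
              exact_mod_cast Finset.card_union_le _ _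
            have h2 : ((A \ H).card : ℝ) + H.card = A.card := by
              exact_mod_cast Finset.card_sdiff_add_card_eq_card hHA
            have h3 : ((J ∩ H).card : ℝ) ≤ q := by exact_mod_cast hJH.le
            nlinarith
          have := potential_add_one_le η M m A.card _ B.card B.card hη hη1 hM hAM hM'
            (by exact_mod_cast Finset.card_le_card hsub) le_rfl (Or.inl hlt)
          push_cast at hpot
          linarith) J hcov hBJ hJm
        refine ⟨p, Finset.mem_biUnion.2 ⟨J ∩ H, Finset.mem_filter.2
          ⟨Finset.mem_powerset.2 (Finset.inter_subset_left.trans hJU), hJH.le⟩,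
          Finset.mem_union_left _ hp⟩, hp'⟩
      · push Not at hJH
        obtain ⟨S, hSJH, hSq⟩ := Finset.exists_subset_card_eq hJH
        have hSJ : S ⊆ J := hSJH.trans Finset.inter_subset_left
        have hSH : S ⊆ H := hSJH.trans Finset.inter_subset_right
        let 𝒬 := J.powerset.filter
          (fun P => (P.card : ℝ) * (q * η / 8) ≤ (((B ∪ (P + S)) \ B).card : ℝ))
        have h𝒬 : 𝒬.Nonempty := ⟨∅, by simp [𝒬]⟩
        obtain ⟨P, hP𝒬, hPmax⟩ := Finset.exists_max_image 𝒬 Finset.card h𝒬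
        obtain ⟨hPJ, hPcard⟩ := Finset.mem_filter.1 hP𝒬
        rw [Finset.mem_powerset] at hPJ
        set B' := B ∪ (P + S) with hB'
        have hB'J : B' ⊆ J + J := Finset.union_subset hBJ (Finset.add_subset_add hPJ hSJ)
        have hcov : J ⊆ small S B' := by
          intro a ha
          refine Finset.mem_filter.2 ⟨hJA ha, ?_⟩
          by_contra! hge
          rw [hSq] at hge
          have hpos : (0 : ℝ) < q * η / 8 := by positivity
          have haP : a ∉ P := by
            intro haP
            have : S.filter (fun v => a + v ∉ B') = ∅ := by
              refine Finset.filter_eq_empty_iff.2 fun v hv => ?_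
              rw [not_not]
              exact Finset.mem_union_right _ (Finset.add_mem_add haP hv)
            rw [this] at hge
            simp at hge
            linarith
          have hmem : insert a P ∈ 𝒬 := by
            refine Finset.mem_filter.2 ⟨Finset.mem_powerset.2
              (Finset.insert_subset ha hPJ), ?_⟩
            have h1 : (S.filter (fun v => a + v ∉ B')).image (fun v => a + v) ∪ (B' \ B) ⊆
                (B ∪ (insert a P + S)) \ B := by
              intro z hz
              rw [Finset.mem_union] at hz
              rcases hz with hz | hz
              · obtain ⟨v, hv, rfl⟩ := Finset.mem_image.1 hz
                obtain ⟨hv, hv'⟩ := Finset.mem_filter.1 hv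
                exact Finset.mem_sdiff.2 ⟨Finset.mem_union_right _
                  (Finset.add_mem_add (Finset.mem_insert_self _ _) hv),
                  fun h => hv' (Finset.mem_union_left _ h)⟩
              · obtain ⟨hz1, hz2⟩ := Finset.mem_sdiff.1 hz
                refine Finset.mem_sdiff.2 ⟨?_, hz2⟩
                exact Finset.union_subset_union_right
                  (Finset.add_subset_add_right (Finset.subset_insert _ _)) hz1
            have h2 : Disjoint ((S.filter (fun v => a + v ∉ B')).image (fun v => a + v))
                (B' \ B) := by
              rw [Finset.disjoint_left]
              intro z hz hz'
              obtain ⟨v, hv, rfl⟩ := Finset.mem_image.1 hz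
              exact (Finset.mem_filter.1 hv).2 (Finset.mem_sdiff.1 hz').1
            have h3 := Finset.card_le_card h1
            rw [Finset.card_union_of_disjoint h2,
              Finset.card_image_of_injective _ (add_right_injective a)] at h3
            have h4 : ((S.filter (fun v => a + v ∉ B')).card : ℝ) + (B' \ B).card ≤
                ((B ∪ (insert a P + S)) \ B).card := by exact_mod_cast h3
            rw [Finset.card_insert_of_notMem haP]
            push_cast
            linarith
          have := hPmax _ hmem
          rw [Finset.card_insert_of_notMem haP] at this
          omega
        obtain ⟨p, hp, hp'⟩ := h𝒟 (small S B') B' ((Finset.filter_subset _ _).trans hAU)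
          (fun hM' => by
            have hprog := card_filter_le_or_le_card_sdiff A B B' S η hη (by omega)
              (fun v hv => (Finset.mem_filter.1 (hSH hv)).2)
            rw [hsdiff] at hprog
            have := potential_add_one_le η M m A.card _ B.card B'.card hη hη1 hM hAM hM'
              (by exact_mod_cast Finset.card_filter_le _ _)
              (by exact_mod_cast Finset.card_le_card Finset.subset_union_left) hprog
            push_cast at hpot
            linarith) J hcov hB'J hJm
        refine ⟨p, Finset.mem_biUnion.2 ⟨S, Finset.mem_filter.2
          ⟨Finset.mem_powerset.2 (hSJ.trans hJU), hSq.le⟩,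
          Finset.mem_union_right _ (Finset.mem_biUnion.2 ⟨P, Finset.mem_filter.2
            ⟨Finset.mem_powerset.2 (hPJ.trans hJU), hPcard⟩, hp⟩)⟩, hp'⟩

/-- If almost all pairs of elements of `A` have their sum in a set of size at most `m`, with `m`
close to `2 * #A`, then almost all of `A` lies in a progression of size close to `m / 2`. -/
theorem exists_subset_progression_of_card_missingPairs_le (A B : Finset ℤ) (m θ : ℝ)
    (hθ : 0 < θ) (hθ1 : θ ≤ 1 / 100) (hm : 1000 ≤ m) (hB : (B.card : ℝ) ≤ m)
    (hA : 9 / 20 * m ≤ A.card)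
    (hbad : ((missingPairs A B).card : ℝ) ≤ θ ^ 2 * (A.card : ℝ) ^ 2) :
    ∃ A' ⊆ A, ((A \ A').card : ℝ) ≤ θ * A.card ∧ (A.card : ℝ) * (2 - 5 * θ) ≤ m + 2 ∧
      ∃ a d : ℤ, d ≠ 0 ∧ ∃ L : ℕ, (L : ℝ) ≤ 2 * m + 11 * θ * A.card - 3 * A.card + 4 ∧
        A' ⊆ (Finset.range L).image (fun i : ℕ => a + (i : ℤ) * d) := by
  have hk0 : (0 : ℝ) < A.card := by linarith
  set A' := A.filter (fun a => ((A.filter (fun b => a + b ∉ B)).card : ℝ) ≤ θ * A.card) with hA'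
  have hA'A : A' ⊆ A := Finset.filter_subset _ _
  have hdiff : ((A \ A').card : ℝ) ≤ θ * A.card := by
    rw [card_missingPairs] at hbad
    push_cast at hbad
    have h1 : ((A \ A').card : ℝ) * (θ * A.card) ≤
        ∑ a ∈ A \ A', ((A.filter (fun b => a + b ∉ B)).card : ℝ) := by
      rw [← nsmul_eq_mul]
      refine Finset.card_nsmul_le_sum _ _ _ fun a ha => ?_
      obtain ⟨h2, h3⟩ := Finset.mem_sdiff.1 ha
      by_contra! h4
      exact h3 (Finset.mem_filter.2 ⟨h2, h4.le⟩)
    have h2 : ∑ a ∈ A \ A', ((A.filter (fun b => a + b ∉ B)).card : ℝ) ≤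
        ∑ a ∈ A, ((A.filter (fun b => a + b ∉ B)).card : ℝ) :=
      Finset.sum_le_sum_of_subset_of_nonneg Finset.sdiff_subset fun _ _ _ => by positivity
    refine le_of_mul_le_mul_right (a := θ * A.card) ?_ (by positivity)
    linarith
  have hcard : ((A \ A').card : ℝ) + A'.card = A.card := by
    exact_mod_cast Finset.card_sdiff_add_card_eq_card hA'A
  have hθk : θ * A.card ≤ 1 / 100 * A.card := by gcongr
  have hA'2 : 2 ≤ A'.card := by
    have : (2 : ℝ) ≤ A'.card := by linarith
    exact_mod_cast this
  obtain ⟨h1, a, d, hd, L, hL, hAP⟩ := exists_progression_of_card_le A' B m (θ * A.card)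
    (A'.card - 1) hB hA'2 rfl (fun a ha => by
      refine le_trans ?_ (Finset.mem_filter.1 ha).2
      exact_mod_cast Finset.card_le_card (Finset.filter_subset_filter _ hA'A)) (by linarith)
  exact ⟨A', hA'A, hdiff, by linarith, a, d, hd, L, by linarith, hAP⟩

theorem choose_mul_pow_le_choose_mul_pow (a b s : ℕ) (hab : a ≤ b) :
    a.choose s * b ^ s ≤ b.choose s * a ^ s := by
  have h : a.descFactorial s * b ^ s ≤ b.descFactorial s * a ^ s := by
    rw [Nat.descFactorial_eq_prod_range, Nat.descFactorial_eq_prod_range,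
      ← Finset.card_range s, ← Finset.prod_const, ← Finset.prod_const, Finset.card_range,
      ← Finset.prod_mul_distrib, ← Finset.prod_mul_distrib]
    refine Finset.prod_le_prod' fun i _ => ?_
    rcases le_total a i with hi | hi
    · simp [Nat.sub_eq_zero_of_le hi]
    · obtain ⟨c, rfl⟩ := Nat.exists_eq_add_of_le hi
      obtain ⟨d, rfl⟩ := Nat.exists_eq_add_of_le hab
      rw [show i + c - i = c by omega, show i + c + d - i = c + d by omega]
      nlinarith [Nat.zero_le (i * d)]
  rw [Nat.descFactorial_eq_factorial_mul_choose, Nat.descFactorial_eq_factorial_mul_choose,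
    mul_assoc, mul_assoc] at h
  exact Nat.le_of_mul_le_mul_left h (Nat.factorial_pos s)

theorem choose_mul_sub_pow_le_choose_mul_sub_pow (a b s : ℕ) (hab : a ≤ b) (hs : s ≤ a) :
    b.choose s * (a - s) ^ s ≤ a.choose s * (b - s) ^ s := by
  have h : b.descFactorial s * (a - s) ^ s ≤ a.descFactorial s * (b - s) ^ s := by
    have key : ∀ x : ℕ, x ^ s = ∏ _i ∈ Finset.range s, x := fun x => by simp
    rw [Nat.descFactorial_eq_prod_range, Nat.descFactorial_eq_prod_range, key (a - s),
      key (b - s), ← Finset.prod_mul_distrib, ← Finset.prod_mul_distrib]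
    refine Finset.prod_le_prod' fun i hi => ?_
    have hi := Finset.mem_range.1 hi
    obtain ⟨c, rfl⟩ := Nat.exists_eq_add_of_lt hi
    obtain ⟨d, rfl⟩ := Nat.exists_eq_add_of_le hs
    obtain ⟨e, rfl⟩ := Nat.exists_eq_add_of_le hab
    rw [show i + c + 1 + d - (i + c + 1) = d by omega,
      show i + c + 1 + d + e - (i + c + 1) = d + e by omega,
      show i + c + 1 + d - i = c + 1 + d by omega,
      show i + c + 1 + d + e - i = c + 1 + d + e by omega]
    nlinarith [Nat.zero_le (c * e)]
  rw [Nat.descFactorial_eq_factorial_mul_choose, Nat.descFactorial_eq_factorial_mul_choose,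
    mul_assoc, mul_assoc] at h
  exact Nat.le_of_mul_le_mul_left h (Nat.factorial_pos s)

theorem choose_le_exp_neg_mul_choose (a b s : ℕ) (δ : ℝ) (hb : 0 < b) (hδ : 0 ≤ δ)
    (hab : (a : ℝ) ≤ (1 - δ) * b) :
    (a.choose s : ℝ) ≤ Real.exp (-(δ * s)) * b.choose s := by
  have hle : a ≤ b := by
    have : (a : ℝ) ≤ b := by nlinarith
    exact_mod_cast this
  have h1 : (a.choose s : ℝ) * (b : ℝ) ^ s ≤ b.choose s * (a : ℝ) ^ s := by
    exact_mod_cast choose_mul_pow_le_choose_mul_pow a b s hle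
  have h2 : (a : ℝ) ≤ Real.exp (-δ) * b := by
    refine hab.trans ?_
    gcongr
    linarith [Real.add_one_le_exp (-δ)]
  have h3 : (a : ℝ) ^ s ≤ Real.exp (-(δ * s)) * (b : ℝ) ^ s := by
    calc (a : ℝ) ^ s ≤ (Real.exp (-δ) * b) ^ s := by gcongr
      _ = Real.exp (-(δ * s)) * (b : ℝ) ^ s := by
        rw [mul_pow, ← Real.exp_nat_mul]; ring_nf
  refine le_of_mul_le_mul_right (a := (b : ℝ) ^ s) ?_ (by positivity)
  calc _ ≤ (b.choose s : ℝ) * (a : ℝ) ^ s := h1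
    _ ≤ b.choose s * (Real.exp (-(δ * s)) * (b : ℝ) ^ s) := by gcongr
    _ = _ := by ring

theorem choose_le_exp_mul_choose_s4 (a b s : ℕ) (δ : ℝ) (hδ : 0 ≤ δ) (hs : s < a)
    (hab : (b : ℝ) - s ≤ (1 + δ) * (a - s)) :
    (b.choose s : ℝ) ≤ Real.exp (δ * s) * a.choose s := by
  rcases le_total b a with hba | hba
  · have h1 : (b.choose s : ℝ) ≤ a.choose s := by
      exact_mod_cast Nat.choose_le_choose s hba
    exact h1.trans (le_mul_of_one_le_left (by positivity) (Real.one_le_exp (by positivity)))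
  · have hpos : (0 : ℝ) < (a - s : ℕ) := by exact_mod_cast (by omega : 0 < a - s)
    have h1 : (b.choose s : ℝ) * ((a - s : ℕ) : ℝ) ^ s ≤ a.choose s * ((b - s : ℕ) : ℝ) ^ s := by
      exact_mod_cast choose_mul_sub_pow_le_choose_mul_sub_pow a b s hba hs.le
    have h2 : ((b - s : ℕ) : ℝ) ≤ Real.exp δ * (a - s : ℕ) := by
      rw [Nat.cast_sub (by omega)]
      refine hab.trans ?_
      rw [Nat.cast_sub hs.le] at hpos ⊢
      gcongr
      linarith [Real.add_one_le_exp δ]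
    have h3 : ((b - s : ℕ) : ℝ) ^ s ≤ Real.exp (δ * s) * ((a - s : ℕ) : ℝ) ^ s := by
      calc ((b - s : ℕ) : ℝ) ^ s ≤ (Real.exp δ * (a - s : ℕ)) ^ s := by gcongr
        _ = Real.exp (δ * s) * ((a - s : ℕ) : ℝ) ^ s := by
          rw [mul_pow, ← Real.exp_nat_mul]; ring_nf
    refine le_of_mul_le_mul_right (a := ((a - s : ℕ) : ℝ) ^ s) ?_ (by positivity)
    calc _ ≤ (a.choose s : ℝ) * ((b - s : ℕ) : ℝ) ^ s := h1
      _ ≤ a.choose s * (Real.exp (δ * s) * ((a - s : ℕ) : ℝ) ^ s) := by gcongr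
      _ = _ := by ring

theorem card_filter_le_card_inter (A W : Finset ℤ) (hW : W ⊆ A) (s t : ℕ) :
    ((A.powersetCard s).filter (fun J => t ≤ (J ∩ W).card)).card ≤
      W.card.choose t * (A.card - t).choose (s - t) := by
  have hsub : (A.powersetCard s).filter (fun J => t ≤ (J ∩ W).card) ⊆
      (W.powersetCard t).biUnion
        (fun T => ((A \ T).powersetCard (s - t)).image (fun X => T ∪ X)) := by
    intro J hJ
    obtain ⟨hJ, ht⟩ := Finset.mem_filter.1 hJ
    obtain ⟨hJA, hJs⟩ := Finset.mem_powersetCard.1 hJ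
    obtain ⟨T, hTJ, hTt⟩ := Finset.exists_subset_card_eq ht
    have hTJ' : T ⊆ J := hTJ.trans Finset.inter_subset_left
    refine Finset.mem_biUnion.2 ⟨T, Finset.mem_powersetCard.2
      ⟨hTJ.trans Finset.inter_subset_right, hTt⟩, Finset.mem_image.2 ⟨J \ T,
      Finset.mem_powersetCard.2 ⟨Finset.sdiff_subset_sdiff hJA le_rfl, ?_⟩, ?_⟩⟩
    · rw [Finset.card_sdiff_of_subset hTJ', hJs, hTt]
    · exact Finset.union_sdiff_of_subset hTJ'
  refine (Finset.card_le_card hsub).trans ?_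
  refine (Finset.card_biUnion_le_card_mul _ _ ((A.card - t).choose (s - t)) fun T hT => ?_).trans
    (by rw [Finset.card_powersetCard])
  obtain ⟨hTW, hTt⟩ := Finset.mem_powersetCard.1 hT
  refine Finset.card_image_le.trans ?_
  rw [Finset.card_powersetCard, Finset.card_sdiff_of_subset (hTW.trans hW), hTt]

theorem card_filter_le_card_inter_le_exp (A W : Finset ℤ) (hW : W ⊆ A) (s t : ℕ) (w : ℝ)
    (hA : 0 < A.card) (ht : 0 < t) (hw : (W.card : ℝ) ≤ w * A.card)
    (hwt : Real.exp 5 * (w * s) ≤ t) :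
    (((A.powersetCard s).filter (fun J => t ≤ (J ∩ W).card)).card : ℝ) ≤
      Real.exp (-(4 * t)) * A.card.choose s := by
  set N := ((A.powersetCard s).filter (fun J => t ≤ (J ∩ W).card)).card with hN
  rcases lt_or_ge (min s A.card) t with hts | hts
  · have : N = 0 := by
      rw [hN, Finset.card_eq_zero, Finset.filter_eq_empty_iff]
      intro J hJ
      obtain ⟨hJA, hJs⟩ := Finset.mem_powersetCard.1 hJ
      have h1 : (J ∩ W).card ≤ J.card := Finset.card_le_card Finset.inter_subset_left
      have h2 := Finset.card_le_card hJA
      have : s ≤ A.card := hJs ▸ h2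
      rw [min_eq_left this] at hts
      omega
    rw [this, Nat.cast_zero]
    positivity
  obtain ⟨hts, htA⟩ := le_min_iff.1 hts
  have hA0 : (0 : ℝ) < A.card := by exact_mod_cast hA
  have ht0 : (0 : ℝ) < t := by exact_mod_cast ht
  have hw0 : 0 ≤ w := by
    by_contra! h
    have : (0 : ℝ) ≤ W.card := by positivity
    nlinarith
  have h1 : (N : ℝ) ≤ W.card.choose t * (A.card - t).choose (s - t) := by
    exact_mod_cast card_filter_le_card_inter A W hW s t
  have h2 : (A.card.choose s : ℝ) * s.choose t =
      A.card.choose t * (A.card - t).choose (s - t) := by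
    exact_mod_cast Nat.choose_mul hts
  have h3 : (W.card.choose t : ℝ) * (A.card : ℝ) ^ t ≤ A.card.choose t * (W.card : ℝ) ^ t := by
    exact_mod_cast choose_mul_pow_le_choose_mul_pow _ _ t (Finset.card_le_card hW)
  have h4 : (W.card.choose t : ℝ) ≤ A.card.choose t * w ^ t := by
    refine le_of_mul_le_mul_right (a := (A.card : ℝ) ^ t) ?_ (by positivity)
    calc _ ≤ A.card.choose t * (W.card : ℝ) ^ t := h3
      _ ≤ A.card.choose t * (w * A.card) ^ t := by gcongr
      _ = _ := by rw [mul_pow]; ring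
  have h5 : w ^ t * (s.choose t : ℝ) ≤ Real.exp (-(4 * t)) := by
    have h6 : (s.choose t : ℝ) ≤ (s : ℝ) ^ t / t.factorial := Nat.choose_le_pow_div t s
    have h7 := Real.pow_div_factorial_le_exp (t : ℝ) ht0.le t
    have hf : (0 : ℝ) < t.factorial := by exact_mod_cast Nat.factorial_pos t
    have h8 : w * s ≤ Real.exp (-5) * t := by
      rw [Real.exp_neg, inv_mul_eq_div, le_div_iff₀ (Real.exp_pos 5)]
      linarith
    rw [div_le_iff₀ hf] at h7
    calc w ^ t * (s.choose t : ℝ) ≤ w ^ t * ((s : ℝ) ^ t / t.factorial) := by gcongr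
      _ = (w * s) ^ t / t.factorial := by rw [mul_pow]; ring
      _ ≤ (Real.exp (-5) * t) ^ t / t.factorial := by
          gcongr ?_ / _
          exact pow_le_pow_left₀ (by positivity) h8 t
      _ ≤ Real.exp (-(4 * t)) := by
          rw [div_le_iff₀ hf, mul_pow, ← Real.exp_nat_mul]
          calc Real.exp (t * -5) * (t : ℝ) ^ t
              ≤ Real.exp (t * -5) * (Real.exp t * t.factorial) := by gcongr
            _ = Real.exp (-(4 * t)) * t.factorial := by
              rw [← mul_assoc, ← Real.exp_add]; ring_nf
  calc (N : ℝ) ≤ W.card.choose t * (A.card - t).choose (s - t) := h1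
    _ ≤ (A.card.choose t * w ^ t) * (A.card - t).choose (s - t) := by gcongr
    _ = w ^ t * (A.card.choose t * (A.card - t).choose (s - t)) := by ring
    _ = (w ^ t * s.choose t) * A.card.choose s := by rw [← h2]; ring
    _ ≤ Real.exp (-(4 * t)) * A.card.choose s := by gcongr

/-- After removing at most `t` elements, `J` lies in a progression of size at most `ℓ`. -/
def IsNearProgression (t ℓ : ℝ) (J : Finset ℤ) : Prop :=
  ∃ T : Finset ℤ, T ⊆ J ∧ (T.card : ℝ) ≤ t ∧ ∃ a d : ℤ, d ≠ 0 ∧ ∃ L : ℕ, (L : ℝ) ≤ ℓ ∧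
    J \ T ⊆ (Finset.range L).image (fun i : ℕ => a + (i : ℤ) * d)

open Classical in
theorem card_filter_not_isNearProgression_le (A B : Finset ℤ) (s k : ℕ) (K ε : ℝ)
    (hK : 2 ≤ K) (hε : 0 < ε) (hε1 : ε ≤ 1 / 2 ^ 20) (hεs : 1000 ≤ ε * s)
    (hk : (K * s - 1) / 2 ≤ k) (hB : (B.card : ℝ) ≤ K * s)
    (hA : (1 - 4 * ε) * (K * s / 2) ≤ A.card)
    (hbad : ((missingPairs A B).card : ℝ) ≤ (32 * ε) ^ 2 * (A.card : ℝ) ^ 2) :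
    (((A.powersetCard s).filter (fun J => ¬ IsNearProgression (2 ^ 15 * (ε * s))
        (K * s / 2 + 2 ^ 17 * (ε * (K * s))) J)).card : ℝ) ≤
      Real.exp (-(3 * ε * s)) * k.choose s := by
  set m := K * s with hm
  have hεm : 2 * (ε * s) ≤ ε * m := by nlinarith
  have hεm' : ε * m ≤ 1 / 2 ^ 20 * m := by gcongr
  obtain ⟨A', hA'A, hdiff, hAm, a, d, hd, L, hL, hAP⟩ :=
    exists_subset_progression_of_card_missingPairs_le A B m (32 * ε) (by positivity)
      (by linarith) (by linarith) hB (by linarith) hbad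
  have hA0 : (0 : ℝ) < A.card := by linarith
  have hεA : ε * A.card ≤ 1 / 2 ^ 20 * A.card := by gcongr
  have hAle : (A.card : ℝ) ≤ m := by linarith
  have hεA' : ε * A.card ≤ ε * m := by gcongr
  set W := A \ A' with hW
  have hWA : W ⊆ A := Finset.sdiff_subset
  have hgood : ∀ J ∈ A.powersetCard s, ((J ∩ W).card : ℝ) ≤ 2 ^ 15 * (ε * s) →
      IsNearProgression (2 ^ 15 * (ε * s)) (m / 2 + 2 ^ 17 * (ε * m)) J := by
    intro J hJ hJW
    refine ⟨J ∩ W, Finset.inter_subset_left, hJW, a, d, hd, L, by linarith, ?_⟩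
    refine Finset.Subset.trans ?_ hAP
    intro x hx
    have hxA := (Finset.mem_powersetCard.1 hJ).1
    simp only [hW, Finset.mem_sdiff, Finset.mem_inter] at hx
    by_contra hxA'
    exact hx.2 ⟨hx.1, hxA hx.1, hxA'⟩
  rcases lt_or_ge K 4 with hK4 | hK4
  · have hempty : (A.powersetCard s).filter (fun J => ¬ IsNearProgression (2 ^ 15 * (ε * s))
        (m / 2 + 2 ^ 17 * (ε * m)) J) = ∅ := by
      refine Finset.filter_eq_empty_iff.2 fun J hJ => ?_
      rw [not_not]
      refine hgood J hJ ?_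
      have h1 : ((J ∩ W).card : ℝ) ≤ W.card := by
        exact_mod_cast Finset.card_le_card Finset.inter_subset_right
      have h2 : ε * m ≤ 4 * (ε * s) := by
        have : ε * s * K ≤ ε * s * 4 := by gcongr
        rw [hm]; linarith
      linarith
    rw [hempty, Finset.card_empty, Nat.cast_zero]
    positivity
  · have hms4 : 4 * s ≤ m := by nlinarith
    set t := ⌊2 ^ 15 * (ε * s)⌋₊ + 1 with ht
    have ht1 : 2 ^ 15 * (ε * s) < t := by
      rw [ht]; push_cast; exact Nat.lt_floor_add_one _
    have hsub : (A.powersetCard s).filter (fun J => ¬ IsNearProgression (2 ^ 15 * (ε * s))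
        (m / 2 + 2 ^ 17 * (ε * m)) J) ⊆
        (A.powersetCard s).filter (fun J => t ≤ (J ∩ W).card) := by
      intro J hJ
      obtain ⟨hJ1, hJ2⟩ := Finset.mem_filter.1 hJ
      refine Finset.mem_filter.2 ⟨hJ1, ?_⟩
      by_contra! hlt
      exact hJ2 (hgood J hJ1 ((Nat.le_floor_iff (by positivity)).1 (by omega)))
    have hexp5 : Real.exp 5 ≤ 2 ^ 8 := by
      have h1 : Real.exp 5 = Real.exp 1 ^ 5 := by rw [← Real.exp_nat_mul]; norm_num
      rw [h1]
      calc Real.exp 1 ^ 5 ≤ (3 : ℝ) ^ 5 := by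
            gcongr; linarith [Real.exp_one_lt_d9]
        _ ≤ 2 ^ 8 := by norm_num
    have h1 := card_filter_le_card_inter_le_exp A W hWA s t (32 * ε) (by exact_mod_cast hA0)
      (by omega) hdiff (by nlinarith)
    have h2 : (A.card.choose s : ℝ) ≤ Real.exp (2 ^ 12 * ε * s) * k.choose s := by
      refine choose_le_exp_mul_choose_s4 k A.card s (2 ^ 12 * ε) (by positivity) ?_ ?_
      · have : (s : ℝ) < k := by linarith
        exact_mod_cast this
      · have h3 : m / 8 ≤ k - s := by linarith
        have h5 : ε * (m / 8) ≤ ε * (k - s) := by gcongr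
        nlinarith
    calc _ ≤ (((A.powersetCard s).filter (fun J => t ≤ (J ∩ W).card)).card : ℝ) := by
          exact_mod_cast Finset.card_le_card hsub
      _ ≤ Real.exp (-(4 * t)) * A.card.choose s := h1
      _ ≤ Real.exp (-(4 * t)) * (Real.exp (2 ^ 12 * ε * s) * k.choose s) := by gcongr
      _ = Real.exp (-(4 * t) + 2 ^ 12 * ε * s) * k.choose s := by rw [Real.exp_add]; ring
      _ ≤ Real.exp (-(3 * ε * s)) * k.choose s := by
          gcongr
          linarith

theorem choose_le_card_filter_card_add_le (n s k : ℕ) (m : ℝ) (hkn : k ≤ n) (hk : 1 ≤ k)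
    (hkm : 2 * (k : ℝ) - 1 ≤ m) :
    k.choose s ≤ (((Finset.Icc 1 (n : ℤ)).powersetCard s).filter
      (fun J => ((J + J).card : ℝ) ≤ m)).card := by
  have hcard : (Finset.Icc 1 (k : ℤ)).card = k := by simp
  conv_lhs => rw [← hcard]
  rw [← Finset.card_powersetCard]
  refine Finset.card_le_card fun J hJ => ?_
  obtain ⟨hJk, hJs⟩ := Finset.mem_powersetCard.1 hJ
  have hsub : Finset.Icc 1 (k : ℤ) ⊆ Finset.Icc 1 (n : ℤ) :=
    Finset.Icc_subset_Icc le_rfl (by exact_mod_cast hkn)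
  refine Finset.mem_filter.2 ⟨Finset.mem_powersetCard.2 ⟨hJk.trans hsub, hJs⟩, ?_⟩
  have h1 : J + J ⊆ Finset.Icc 2 (2 * k : ℤ) := by
    intro z hz
    obtain ⟨a, ha, b, hb, rfl⟩ := Finset.mem_add.1 hz
    have ha := Finset.mem_Icc.1 (hJk ha)
    have hb := Finset.mem_Icc.1 (hJk hb)
    exact Finset.mem_Icc.2 ⟨by omega, by omega⟩
  have h2 := Finset.card_le_card h1
  rw [Int.card_Icc] at h2
  have h3 : (J + J).card + 1 ≤ 2 * k := by omega
  have h4 : ((J + J).card : ℝ) + 1 ≤ 2 * k := by exact_mod_cast h3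
  linarith

theorem exists_containers_card_le_exp (n s : ℕ) (K ε : ℝ) (hn : 12 ≤ n) (hL : 1 ≤ Real.log n)
    (hK : 2 ≤ K) (hKs : K * Real.log n ^ 3 ≤ s) (hε : 0 < ε) (hε1 : ε ≤ 1 / 2 ^ 20)
    (hε6 : ε ^ 6 * s = K * Real.log n ^ 3) :
    ∃ 𝒞 : Finset (Finset ℤ × Finset ℤ), (𝒞.card : ℝ) ≤ Real.exp (ε * s) ∧
      ∀ J : Finset ℤ, J ⊆ Finset.Icc 1 (n : ℤ) → ((J + J).card : ℝ) ≤ K * s →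
        ∃ p ∈ 𝒞, J ⊆ p.1 ∧ p.2 ⊆ J + J ∧ ((p.1.card : ℝ) < K * s / 4 ∨
          ((missingPairs p.1 p.2).card : ℝ) ≤ (32 * ε) ^ 2 * (p.1.card : ℝ) ^ 2) := by
  set L := Real.log n with hLdef
  set m := K * s with hm
  have hn0 : (0 : ℝ) < n := by exact_mod_cast (by omega : 0 < n)
  have hL3 : L ≤ L ^ 3 := le_self_pow₀ hL (by norm_num)
  have hsL : 2 * L ≤ s := by nlinarith
  have hs0 : (0 : ℝ) < s := by linarith
  have hms : 2 * s ≤ m := by nlinarith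
  have hm0 : 0 < m := by linarith
  set x := Real.sqrt (m / L) with hx
  have hx2 : x ^ 2 * L = m := by
    rw [hx, Real.sq_sqrt (by positivity)]
    field_simp
  have hx1 : 1 ≤ x := by
    rw [hx, Real.one_le_sqrt, le_div_iff₀ (by linarith)]
    linarith
  have hεx : ε ^ 3 * s = x * L ^ 2 := by
    have h1 : (ε ^ 3 * s) ^ 2 = (x * L ^ 2) ^ 2 := by
      calc (ε ^ 3 * s) ^ 2 = ε ^ 6 * s * s := by ring
        _ = m * L ^ 3 := by rw [hε6, hm]; ring
        _ = _ := by rw [← hx2]; ring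
    exact (pow_left_inj₀ (by positivity) (by positivity) two_ne_zero).1 h1
  set q := ⌈x⌉₊ with hq
  have hq1 : 1 ≤ q := Nat.one_le_ceil_iff.2 (by linarith)
  have hxq : x ≤ q := Nat.le_ceil x
  have hq2 : (q : ℝ) ≤ 2 * x := by
    have := Nat.ceil_lt_add_one (show 0 ≤ x by linarith)
    linarith
  have hx0 : 0 < x := by linarith
  set η := (32 * ε) ^ 2 with hη
  have hη0 : 0 < η := by positivity
  have hη1 : η ≤ 1 := by
    rw [hη]
    exact pow_le_one₀ (by positivity) (by linarith)
  have hqM : (q : ℝ) ≤ η * (m / 4) / 4 := by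
    have h1 : x ≤ ε ^ 2 * m := by
      have h2 : ε * x ≤ ε * (ε ^ 2 * m) := by
        have h3 : ε * (ε ^ 2 * m) = K * (x * L ^ 2) := by rw [← hεx, hm]; ring
        rw [h3]
        have h4 : x ≤ x * L ^ 2 := le_mul_of_one_le_right hx0.le (one_le_pow₀ hL)
        nlinarith
      exact le_of_mul_le_mul_left h2 hε
    have h5 : η * (m / 4) / 4 = 64 * (ε ^ 2 * m) := by rw [hη]; ring
    rw [h5]
    linarith
  set ρ := 24 / η * L with hρ
  have hρ0 : 0 ≤ ρ := by positivity
  set r := ⌊ρ⌋₊ + 1 with hr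
  have hrρ : ρ < r := by rw [hr]; push_cast; exact Nat.lt_floor_add_one ρ
  have hr25 : (r : ℝ) ≤ 25 / η * L := by
    have h1 : (r : ℝ) ≤ ρ + 1 := by
      rw [hr]; push_cast; linarith [Nat.floor_le hρ0]
    have h2 : 1 ≤ 1 / η * L := by
      rw [one_div, inv_mul_eq_div, le_div_iff₀ hη0]; linarith
    have h3 : 25 / η * L = ρ + 1 / η * L := by rw [hρ]; ring
    linarith
  have hUcard : (Finset.Icc 1 (n : ℤ)).card = n := by simp
  obtain ⟨𝒞, h𝒞card, h𝒞⟩ := exists_containers (Finset.Icc 1 (n : ℤ)) n q η (m / 4) m (by omega)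
    hUcard.le hq1 hη0 hη1 (by linarith) hqM r (Finset.Icc 1 (n : ℤ)) ∅ le_rfl (fun _ => by
      refine lt_of_le_of_lt ?_ hrρ
      rw [hUcard, Finset.card_empty, Nat.cast_zero, sub_zero]
      have h1 : Real.log (n / (m / 4)) ≤ L :=
        Real.log_le_log (by positivity) (div_le_self hn0.le (by linarith))
      have h2 : m * (4 / (η * (m / 4))) = 16 / η := by field_simp; norm_num
      have h3 : 8 / η * Real.log (n / (m / 4)) ≤ 8 / η * L := by gcongr
      have h4 : 16 / η ≤ 16 / η * L := le_mul_of_one_le_right (by positivity) hL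
      have h5 : ρ = 8 / η * L + 16 / η * L := by rw [hρ]; ring
      linarith)
  refine ⟨𝒞, h𝒞card.trans ?_, fun J hJ hJm => h𝒞 J hJ (Finset.empty_subset _) hJm⟩
  have hnexp : (n : ℝ) = Real.exp L := (Real.exp_log hn0).symm
  have h12 : 12 * (n : ℝ) ^ q ≤ Real.exp (2 * q * L) := by
    have h1 : (12 : ℝ) ≤ (n : ℝ) ^ q := by
      have h2 : (12 : ℝ) ≤ n := by exact_mod_cast hn
      exact h2.trans (le_self_pow₀ (by linarith) (by omega))
    calc 12 * (n : ℝ) ^ q ≤ (n : ℝ) ^ q * (n : ℝ) ^ q := by gcongr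
      _ = Real.exp (2 * q * L) := by
        rw [hnexp, ← Real.exp_nat_mul, ← Real.exp_add]; ring_nf
  have hrpow : (n : ℝ) ^ (8 / (q * η) * (m - (Finset.card (∅ : Finset ℤ) : ℝ))) =
      Real.exp (8 / (q * η) * m * L) := by
    rw [Real.rpow_def_of_pos hn0, Finset.card_empty, Nat.cast_zero, sub_zero, mul_comm]
  rw [hrpow]
  calc _ ≤ Real.exp (2 * q * L) ^ r * Real.exp (8 / (q * η) * m * L) := by gcongr
    _ = Real.exp (r * (2 * q * L) + 8 / (q * η) * m * L) := by
      rw [← Real.exp_nat_mul, ← Real.exp_add]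
    _ ≤ Real.exp (ε * s) := by
      refine Real.exp_le_exp.2 ?_
      have h1 : (r : ℝ) * (2 * q * L) ≤ 25 / η * L * (2 * (2 * x) * L) := by gcongr
      have h2 : 8 / (q * η) * m * L ≤ 8 / (x * η) * m * L := by gcongr
      have h3 : 8 / (x * η) * m * L = 8 / η * (x * L ^ 2) := by
        rw [← hx2]; field_simp
      have h4 : 25 / η * L * (2 * (2 * x) * L) = 100 / η * (x * L ^ 2) := by ring
      have h5 : 108 / η * (x * L ^ 2) = 108 / 1024 * (ε * s) := by
        rw [← hεx, hη]; field_simp; norm_num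
      have h6 : 100 / η * (x * L ^ 2) + 8 / η * (x * L ^ 2) = 108 / η * (x * L ^ 2) := by ring
      have h7 : 0 ≤ ε * s := by positivity
      linarith

open Classical in
theorem card_not_isNearProgression_le (n s : ℕ) (K ε : ℝ) (hn : 12 ≤ n) (hL : 1 ≤ Real.log n)
    (hK : 2 ≤ K) (hKs : K * Real.log n ^ 3 ≤ s) (hε : 0 < ε) (hε1 : ε ≤ 1 / 2 ^ 20)
    (hε6 : ε ^ 6 * s = K * Real.log n ^ 3) :
    (((((Finset.Icc 1 (n : ℤ)).powersetCard s).filter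
        (fun J => ((J + J).card : ℝ) ≤ K * s)).filter
          (fun J => ¬ IsNearProgression (2 ^ 15 * (ε * s))
            (K * s / 2 + 2 ^ 17 * (ε * (K * s))) J)).card : ℝ) ≤
      Real.exp (-(ε * s)) * (((Finset.Icc 1 (n : ℤ)).powersetCard s).filter
        (fun J => ((J + J).card : ℝ) ≤ K * s)).card := by
  set 𝒥 := ((Finset.Icc 1 (n : ℤ)).powersetCard s).filter
    (fun J => ((J + J).card : ℝ) ≤ K * s) with h𝒥
  have hs0 : (0 : ℝ) ≤ s := by positivity
  have hεs : 1000 ≤ ε * s := by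
    by_contra! h
    have h1 : (1 : ℝ) ≤ ε ^ 6 * s := by
      rw [hε6]
      have := one_le_pow₀ (n := 3) hL
      nlinarith
    have h2 : ε ^ 5 ≤ (1 / 2 ^ 20) ^ 5 := by gcongr
    have h3 : ε ^ 6 * s = ε ^ 5 * (ε * s) := by ring
    have h4 : ε ^ 5 * (ε * s) ≤ (1 / 2 ^ 20) ^ 5 * 1000 := by gcongr
    norm_num at h4
    linarith
  have hms : 2 * s ≤ K * s := by nlinarith
  have hsε : ε * s ≤ 1 * s := by gcongr; linarith
  have hεm : 2 * (ε * s) ≤ ε * (K * s) := by nlinarith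
  set k := ⌊(K * s + 1) / 2⌋₊ with hk
  have hk1 : (k : ℝ) ≤ (K * s + 1) / 2 := Nat.floor_le (by linarith)
  have hk2 : (K * s + 1) / 2 < k + 1 := Nat.lt_floor_add_one _
  have hkpos : 1 ≤ k := by
    have : (0 : ℝ) < k := by linarith
    exact_mod_cast this
  rcases lt_or_ge n k with hnk | hnk
  · have hempty : 𝒥.filter (fun J => ¬ IsNearProgression (2 ^ 15 * (ε * s))
        (K * s / 2 + 2 ^ 17 * (ε * (K * s))) J) = ∅ := by
      refine Finset.filter_eq_empty_iff.2 fun J hJ => ?_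
      rw [not_not]
      have hJn := (Finset.mem_powersetCard.1 (Finset.mem_filter.1 hJ).1).1
      have hnk' : (n : ℝ) + 1 ≤ k := by exact_mod_cast hnk
      refine ⟨∅, Finset.empty_subset _, by rw [Finset.card_empty, Nat.cast_zero]; positivity,
        1, 1, one_ne_zero, n, by linarith, fun z hz => ?_⟩
      have hz := Finset.mem_Icc.1 (hJn (Finset.mem_sdiff.1 hz).1)
      exact Finset.mem_image.2 ⟨(z - 1).toNat, Finset.mem_range.2 (by omega), by omega⟩
    rw [hempty, Finset.card_empty, Nat.cast_zero]
    positivity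
  obtain ⟨𝒞, h𝒞card, h𝒞⟩ := exists_containers_card_le_exp n s K ε hn hL hK hKs hε hε1 hε6
  let 𝓕 : Finset ℤ × Finset ℤ → Finset (Finset ℤ) := fun p =>
    if (p.2.card : ℝ) ≤ K * s ∧ ((p.1.card : ℝ) < K * s / 4 ∨
        ((missingPairs p.1 p.2).card : ℝ) ≤ (32 * ε) ^ 2 * (p.1.card : ℝ) ^ 2) then
      (p.1.powersetCard s).filter (fun J => ¬ IsNearProgression (2 ^ 15 * (ε * s))
        (K * s / 2 + 2 ^ 17 * (ε * (K * s))) J)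
    else ∅
  have hcover : 𝒥.filter (fun J => ¬ IsNearProgression (2 ^ 15 * (ε * s))
      (K * s / 2 + 2 ^ 17 * (ε * (K * s))) J) ⊆ 𝒞.biUnion 𝓕 := by
    intro J hJ
    obtain ⟨hJ, hbad⟩ := Finset.mem_filter.1 hJ
    obtain ⟨hJ, hJK⟩ := Finset.mem_filter.1 hJ
    obtain ⟨hJn, hJs⟩ := Finset.mem_powersetCard.1 hJ
    obtain ⟨p, hp, hJp, hpJ, hp'⟩ := h𝒞 J hJn hJK
    refine Finset.mem_biUnion.2 ⟨p, hp, ?_⟩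
    have hpK : (p.2.card : ℝ) ≤ K * s :=
      le_trans (by exact_mod_cast Finset.card_le_card hpJ) hJK
    simp only [𝓕]
    rw [if_pos ⟨hpK, hp'⟩]
    exact Finset.mem_filter.2 ⟨Finset.mem_powersetCard.2 ⟨hJp, hJs⟩, hbad⟩
  have h𝓕 : ∀ p, ((𝓕 p).card : ℝ) ≤ Real.exp (-(3 * ε * s)) * k.choose s := by
    intro p
    simp only [𝓕]
    split_ifs with hp
    · obtain ⟨hpK, hp⟩ := hp
      rcases lt_or_ge (p.1.card : ℝ) ((1 - 4 * ε) * (K * s / 2)) with hsmall | hlarge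
      · have h1 : (p.1.card.choose s : ℝ) ≤ Real.exp (-(3 * ε * s)) * k.choose s :=
          choose_le_exp_neg_mul_choose p.1.card k s (3 * ε) hkpos (by positivity) (by nlinarith)
        refine le_trans ?_ h1
        rw [← Finset.card_powersetCard]
        exact_mod_cast Finset.card_filter_le _ _
      · refine card_filter_not_isNearProgression_le p.1 p.2 s k K ε hK hε hε1 hεs (by linarith)
          hpK hlarge (hp.resolve_left fun h => ?_)
        nlinarith
    · rw [Finset.card_empty, Nat.cast_zero]
      positivity
  have hchoose : (k.choose s : ℝ) ≤ 𝒥.card := by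
    exact_mod_cast choose_le_card_filter_card_add_le n s k (K * s) hnk hkpos (by linarith)
  calc _ ≤ ((𝒞.biUnion 𝓕).card : ℝ) := by exact_mod_cast Finset.card_le_card hcover
    _ ≤ ∑ p ∈ 𝒞, ((𝓕 p).card : ℝ) := by exact_mod_cast Finset.card_biUnion_le
    _ ≤ 𝒞.card * (Real.exp (-(3 * ε * s)) * k.choose s) := by
      rw [← nsmul_eq_mul]
      exact Finset.sum_le_card_nsmul _ _ _ fun p _ => h𝓕 p
    _ ≤ Real.exp (ε * s) * (Real.exp (-(3 * ε * s)) * 𝒥.card) := by gcongr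
    _ = Real.exp (ε * s + -(3 * ε * s)) * 𝒥.card := by rw [Real.exp_add]; ring
    _ ≤ Real.exp (-(ε * s)) * 𝒥.card := by
      gcongr
      nlinarith

open Pointwise

/-- Let `s` and `n ≥ 2` be integers and `2 ≤ K ≤ s/(2^120·(log n)^3)`.
All but an `exp(-K^(1/6)·s^(5/6)·√(log n))`-fraction of the sets `J ⊆ [n]` with
`|J| = s` and `|J+J| ≤ K·s` admit a subset `T ⊆ J` with
`|T| ≤ 2^15·K^(1/6)·s^(5/6)·√(log n)` such that `J \ T` is contained in an arithmetic
progression of size at most `Ks/2 + 2^17·K^(7/6)·s^(5/6)·√(log n)`. -/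
theorem typical_structure_small_doubling_quantitative
    (s n : ℕ) (hn : 2 ≤ n)
    (K : ℝ) (hK2 : 2 ≤ K) (hKs : K ≤ s / (2 ^ 120 * (Real.log n) ^ 3)) :
    (Nat.card {J : Finset ℤ | J ⊆ Finset.Icc 1 (n : ℤ) ∧ J.card = s ∧
          ((J + J).card : ℝ) ≤ K * s} : ℝ) -
      (Nat.card {J : Finset ℤ | (J ⊆ Finset.Icc 1 (n : ℤ) ∧ J.card = s ∧
          ((J + J).card : ℝ) ≤ K * s) ∧
          ∃ T : Finset ℤ, T ⊆ J ∧
            ((T.card : ℝ) ≤ 2 ^ 15 * K ^ ((1 : ℝ) / 6) * (s : ℝ) ^ ((5 : ℝ) / 6) *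
              Real.sqrt (Real.log n)) ∧
            ∃ a d : ℤ, d ≠ 0 ∧ ∃ L : ℕ,
              ((L : ℝ) ≤ K * s / 2 + 2 ^ 17 * K ^ ((7 : ℝ) / 6) * (s : ℝ) ^ ((5 : ℝ) / 6) *
                Real.sqrt (Real.log n)) ∧
              J \ T ⊆ (Finset.range L).image (fun i : ℕ => a + (i : ℤ) * d)} : ℝ) ≤
    Real.exp (-(K ^ ((1 : ℝ) / 6) * (s : ℝ) ^ ((5 : ℝ) / 6) * Real.sqrt (Real.log n))) *
      (Nat.card {J : Finset ℤ | J ⊆ Finset.Icc 1 (n : ℤ) ∧ J.card = s ∧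
          ((J + J).card : ℝ) ≤ K * s} : ℝ) := by
  classical
  set L := Real.log n with hLdef
  have hn0 : (0 : ℝ) < n := by exact_mod_cast (by omega : 0 < n)
  have hL2 : 1 / 2 < L := by
    have h1 : Real.log 2 ≤ L := Real.log_le_log (by norm_num) (by exact_mod_cast hn)
    linarith [Real.log_two_gt_d9]
  have hKs' : K * (2 ^ 120 * L ^ 3) ≤ s := (le_div_iff₀ (by positivity)).1 hKs
  have hs0 : (0 : ℝ) < s := lt_of_lt_of_le (by positivity) hKs'
  set ε := (K / s) ^ ((1 : ℝ) / 6) * Real.sqrt L with hε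
  have hεpos : 0 < ε := by positivity
  have hsqrt : Real.sqrt L ^ 6 = L ^ 3 := by
    rw [show 6 = 2 * 3 from rfl, pow_mul, Real.sq_sqrt (by linarith)]
  have hε6 : ε ^ 6 * s = K * L ^ 3 := by
    rw [hε, mul_pow, hsqrt, ← Real.rpow_natCast, ← Real.rpow_mul (by positivity)]
    norm_num
    field_simp
  have hε1 : ε ≤ 1 / 2 ^ 20 := by
    refine le_of_pow_le_pow_left₀ (n := 6) (by norm_num) (by norm_num) ?_
    refine le_of_mul_le_mul_right (a := (s : ℝ)) ?_ hs0
    rw [hε6]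
    linarith
  have hscale : K ^ ((1 : ℝ) / 6) * (s : ℝ) ^ ((5 : ℝ) / 6) * Real.sqrt L = ε * s := by
    have h1 : (s : ℝ) ^ ((5 : ℝ) / 6) * (s : ℝ) ^ ((1 : ℝ) / 6) = s := by
      rw [← Real.rpow_add hs0]; norm_num
    rw [hε, Real.div_rpow (by linarith) hs0.le]
    have hp : (0 : ℝ) < (s : ℝ) ^ ((1 : ℝ) / 6) := by positivity
    rw [div_mul_eq_mul_div, div_mul_eq_mul_div, eq_div_iff hp.ne']
    linear_combination K ^ ((1 : ℝ) / 6) * Real.sqrt L * h1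
  have hscaleK : K ^ ((7 : ℝ) / 6) * (s : ℝ) ^ ((5 : ℝ) / 6) * Real.sqrt L = ε * (K * s) := by
    have h1 : K ^ ((7 : ℝ) / 6) = K * K ^ ((1 : ℝ) / 6) := by
      rw [← Real.rpow_one_add' (by linarith) (by norm_num)]; norm_num
    rw [h1]
    linear_combination K * hscale
  set 𝒥 := ((Finset.Icc 1 (n : ℤ)).powersetCard s).filter
    (fun J => ((J + J).card : ℝ) ≤ K * s) with h𝒥
  have hmem : ∀ J, J ∈ 𝒥 ↔ J ⊆ Finset.Icc 1 (n : ℤ) ∧ J.card = s ∧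
      ((J + J).card : ℝ) ≤ K * s := fun J => by
    rw [h𝒥, Finset.mem_filter, Finset.mem_powersetCard, and_assoc]
  have hN : Nat.card {J : Finset ℤ | J ⊆ Finset.Icc 1 (n : ℤ) ∧ J.card = s ∧
      ((J + J).card : ℝ) ≤ K * s} = 𝒥.card := by
    rw [Nat.card_coe_set_eq, ← Set.ncard_coe_finset]
    congr 1
    ext J
    exact (hmem J).symm
  have hN' : Nat.card {J : Finset ℤ | (J ⊆ Finset.Icc 1 (n : ℤ) ∧ J.card = s ∧
      ((J + J).card : ℝ) ≤ K * s) ∧ IsNearProgression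
        (2 ^ 15 * K ^ ((1 : ℝ) / 6) * (s : ℝ) ^ ((5 : ℝ) / 6) * Real.sqrt L)
        (K * s / 2 + 2 ^ 17 * K ^ ((7 : ℝ) / 6) * (s : ℝ) ^ ((5 : ℝ) / 6) * Real.sqrt L) J} =
      (𝒥.filter (fun J => IsNearProgression (2 ^ 15 * (ε * s))
        (K * s / 2 + 2 ^ 17 * (ε * (K * s))) J)).card := by
    have e1 : 2 ^ 15 * K ^ ((1 : ℝ) / 6) * (s : ℝ) ^ ((5 : ℝ) / 6) * Real.sqrt L =
        2 ^ 15 * (ε * s) := by rw [← hscale]; ring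
    have e2 : 2 ^ 17 * K ^ ((7 : ℝ) / 6) * (s : ℝ) ^ ((5 : ℝ) / 6) * Real.sqrt L =
        2 ^ 17 * (ε * (K * s)) := by rw [← hscaleK]; ring
    rw [Nat.card_coe_set_eq, ← Set.ncard_coe_finset, e1, e2]
    congr 1
    ext J
    rw [Finset.mem_coe, Finset.mem_filter, hmem]
    rfl
  have hsplit := Finset.card_filter_add_card_filter_not (s := 𝒥)
    (fun J => IsNearProgression (2 ^ 15 * (ε * s)) (K * s / 2 + 2 ^ 17 * (ε * (K * s))) J)
  have hbound : (((𝒥.filter (fun J => ¬ IsNearProgression (2 ^ 15 * (ε * s))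
      (K * s / 2 + 2 ^ 17 * (ε * (K * s))) J)).card : ℕ) : ℝ) ≤
      Real.exp (-(ε * s)) * 𝒥.card := by
    rcases lt_or_ge n s with hns | hns
    · have h𝒥0 : 𝒥 = ∅ := by
        rw [h𝒥, Finset.powersetCard_eq_empty.2 (by simpa using hns), Finset.filter_empty]
      rw [h𝒥0]
      simp
    · have hL3 : (1 / 2) ^ 3 ≤ L ^ 3 := by gcongr
      have hs16 : (16 : ℝ) ≤ s := by nlinarith
      have hn16 : (16 : ℝ) ≤ n := hs16.trans (by exact_mod_cast hns)
      have hL1 : 1 ≤ L := by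
        rw [hLdef, Real.le_log_iff_exp_le hn0]
        linarith [Real.exp_one_lt_d9]
      have hn12 : 12 ≤ n := by
        have : (12 : ℝ) ≤ n := by linarith
        exact_mod_cast this
      exact card_not_isNearProgression_le n s K ε hn12 hL1 hK2
        (le_trans (by nlinarith [show 0 ≤ K * L ^ 3 by positivity]) hKs') hεpos hε1 hε6
  have hsplit' : ((𝒥.filter (fun J => IsNearProgression (2 ^ 15 * (ε * s))
      (K * s / 2 + 2 ^ 17 * (ε * (K * s))) J)).card : ℝ) +
      ((𝒥.filter (fun J => ¬ IsNearProgression (2 ^ 15 * (ε * s))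
        (K * s / 2 + 2 ^ 17 * (ε * (K * s))) J)).card : ℝ) = 𝒥.card := by
    exact_mod_cast hsplit
  have hN'' := congrArg (Nat.cast : ℕ → ℝ) hN'
  unfold IsNearProgression at hN''
  rw [hN, hN'', hscale]
  unfold IsNearProgression at hsplit' hbound
  linarith
end
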